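/- arXiv:2507.07200 — 2 statements merged into one kernel-verified Lean document; each statement's English description precedes it below -/
import Mathlib

section
/- Let X be a Polish space, p ≥ 1, μ ∈ P(X), ν ∈ P_p(ℝ^d), and let C : X × P_p(ℝ^d) → [0,∞] be lower semicontinuous and convex in its second argument. If C is decreasing in the increasing convex order in its second argument (i.e. ρ₁ ≼_icx ρ₂ implies C(x,ρ₁) ≥ C(x,ρ₂) for all x ∈ X), then inf_{π ∈ Π(μ,ν)} ∫_X C(x, π_x) dμ(x) = sup { ∫_X ψ^C dμ − ∫_{ℝ^d} ψ dν : ψ ∈ C_{b,p}(ℝ^d), ψ convex and coordinatewise increasing }. -/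
open MeasureTheory Set Filter Topology
open scoped ENNReal

noncomputable section

/-- `ℝ^d`, modelled as Euclidean space. -/
abbrev Rd (d : ℕ) : Type := EuclideanSpace ℝ (Fin d)

/-- A Borel measure on `ℝ^d` has finite `p`-th moment. -/
def HasMomentP (p : ℝ) {d : ℕ} (ρ : Measure (Rd d)) : Prop :=
  ∫⁻ y, ENNReal.ofReal (‖y‖ ^ p) ∂ρ ≠ ⊤

/-- `P_p(ℝ^d)`: Borel probability measures on `ℝ^d` with finite `p`-th moment. -/
abbrev Pp (p : ℝ) (d : ℕ) : Type :=
  {ρ : Measure (Rd d) // IsProbabilityMeasure ρ ∧ HasMomentP p ρ}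

/-- Continuous test functions of growth of order at most `p`. -/
def GrowthP (p : ℝ) {d : ℕ} (f : Rd d → ℝ) : Prop :=
  Continuous f ∧ ∃ K : ℝ, ∀ y, |f y| ≤ K * (1 + ‖y‖ ^ p)

/-- The `p`-weak topology on `P_p(ℝ^d)`: the initial topology induced by integration
against continuous functions of growth of order at most `p`. -/
instance PpTopology (p : ℝ) (d : ℕ) : TopologicalSpace (Pp p d) :=
  ⨅ f : {f : Rd d → ℝ // GrowthP p f},
    TopologicalSpace.induced (fun ρ : Pp p d => ∫ y, f.1 y ∂ρ.1) inferInstance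

instance PpMeasurableSpace (p : ℝ) (d : ℕ) : MeasurableSpace (Pp p d) := borel _

/-- `C_{b,p}(ℝ^d)`: continuous functions bounded from below by a constant and bounded
above by `K (1 + |y - y₀|^p)` for some `K > 0`, `y₀`. -/
def Cbp (p : ℝ) {d : ℕ} (ψ : Rd d → ℝ) : Prop :=
  Continuous ψ ∧ (∃ c : ℝ, ∀ y, c ≤ ψ y) ∧
    ∃ K : ℝ, 0 < K ∧ ∃ y₀ : Rd d, ∀ y, ψ y ≤ K * (1 + ‖y - y₀‖ ^ p)

open scoped Classical in
/-- The nonnegative part of an extended real, as an extended nonnegative real. -/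
def erealToENN (x : EReal) : ℝ≥0∞ := if x = ⊤ then ⊤ else ENNReal.ofReal x.toReal

/-- Canonical extended integral of an `EReal`-valued function: the lower integral of the
positive part minus the lower integral of the negative part. -/
def eInt {α : Type*} [MeasurableSpace α] (μ : Measure α) (f : α → EReal) : EReal :=
  ((∫⁻ x, erealToENN (f x) ∂μ : ℝ≥0∞) : EReal) -
    ((∫⁻ x, erealToENN (-(f x)) ∂μ : ℝ≥0∞) : EReal)

/-- The convex order on measures on `ℝ^d`: `ρ₁ ≼_c ρ₂` iff `∫ f dρ₁ ≤ ∫ f dρ₂` for every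
convex function `f : ℝ^d → ℝ` (integrals taken in the extended sense). -/
def ConvexOrder {d : ℕ} (ρ₁ ρ₂ : Measure (Rd d)) : Prop :=
  ∀ f : Rd d → ℝ, ConvexOn ℝ univ f →
    eInt ρ₁ (fun y => (f y : EReal)) ≤ eInt ρ₂ (fun y => (f y : EReal))

/-- Coordinatewise increasing functions on `ℝ^d`. -/
def CoordMono {d : ℕ} (f : Rd d → ℝ) : Prop :=
  ∀ y z : Rd d, (∀ i, y i ≤ z i) → f y ≤ f z

/-- The increasing convex order on measures on `ℝ^d`. -/
def IcxOrder {d : ℕ} (ρ₁ ρ₂ : Measure (Rd d)) : Prop :=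
  ∀ f : Rd d → ℝ, ConvexOn ℝ univ f → CoordMono f →
    eInt ρ₁ (fun y => (f y : EReal)) ≤ eInt ρ₂ (fun y => (f y : EReal))

/-- `π` is a coupling of `μ` and `ν`. -/
def IsCoupling {X Y : Type*} [MeasurableSpace X] [MeasurableSpace Y]
    (π : Measure (X × Y)) (μ : Measure X) (ν : Measure Y) : Prop :=
  IsProbabilityMeasure π ∧ π.map Prod.fst = μ ∧ π.map Prod.snd = ν

open scoped Classical in
/-- Disintegration of a measure on a product space with respect to its first marginal. -/
def disint {X : Type*} [MeasurableSpace X] {Y : Type*} [MeasurableSpace Y]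
    [StandardBorelSpace Y] [Nonempty Y] (π : Measure (X × Y)) :
    ProbabilityTheory.Kernel X Y :=
  if h : IsFiniteMeasure π then (haveI := h; π.condKernel) else 0

/-- The primal weak optimal transport value `inf_{π ∈ Π(μ,ν)} ∫ C(x, π_x) dμ(x)`. -/
def primal {X : Type*} [MeasurableSpace X] {d : ℕ}
    (μ : Measure X) (ν : Measure (Rd d)) (C : X → Measure (Rd d) → ℝ≥0∞) : ℝ≥0∞ :=
  ⨅ π : {π : Measure (X × Rd d) // IsCoupling π μ ν}, ∫⁻ x, C x (disint π.1 x) ∂μ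

/-- The `C`-conjugate `ψ^C (x) = inf_{ρ ∈ P_p} ρ(ψ) + C(x, ρ)`. -/
def conj (p : ℝ) {X : Type*} [MeasurableSpace X] {d : ℕ}
    (C : X → Measure (Rd d) → ℝ≥0∞) (ψ : Rd d → ℝ) (x : X) : EReal :=
  ⨅ ρ : Pp p d, ((∫ y, ψ y ∂ρ.1 : ℝ) : EReal) + ((C x ρ.1 : ℝ≥0∞) : EReal)

/-- The dual value `μ(ψ^C) - ν(ψ)`. -/
def dualVal (p : ℝ) {X : Type*} [MeasurableSpace X] {d : ℕ}
    (μ : Measure X) (ν : Measure (Rd d)) (C : X → Measure (Rd d) → ℝ≥0∞)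
    (ψ : Rd d → ℝ) : EReal :=
  eInt μ (conj p C ψ) - ((∫ y, ψ y ∂ν : ℝ) : EReal)

end

namespace WeakTransport

variable {p : ℝ} {d : ℕ}

/-- The weight `1 + ‖y‖ ^ p`. -/
noncomputable def wt (p : ℝ) {d : ℕ} (y : Rd d) : ℝ := 1 + ‖y‖ ^ p

lemma one_le_wt (y : Rd d) : 1 ≤ wt p y := by
  have : 0 ≤ ‖y‖ ^ p := by positivity
  unfold wt; linarith

lemma wt_nonneg (y : Rd d) : 0 ≤ wt p y := zero_le_one.trans (one_le_wt y)

lemma continuous_wt (hp : 1 ≤ p) : Continuous (wt p : Rd d → ℝ) :=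
  continuous_const.add (continuous_norm.rpow_const fun _ => Or.inr (by linarith))

instance isProbabilityMeasure_coe (ρ : Pp p d) : IsProbabilityMeasure ρ.1 := ρ.2.1

lemma growthP_of_le {f : Rd d → ℝ} (hf : Continuous f) (K : ℝ) (h : ∀ y, |f y| ≤ K * wt p y) :
    GrowthP p f := ⟨hf, K, h⟩

lemma growthP_of_bounded {f : Rd d → ℝ} (hf : Continuous f) (K : ℝ) (h : ∀ y, |f y| ≤ K) :
    GrowthP p f := by
  refine ⟨hf, K, fun y => ?_⟩
  have h1 := one_le_wt (p := p) y
  have h0 : 0 ≤ K := (abs_nonneg _).trans (h y)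
  exact (h y).trans (le_mul_of_one_le_right h0 h1)

lemma growthP_const (c : ℝ) : GrowthP p (fun _ : Rd d => c) :=
  growthP_of_bounded continuous_const |c| fun _ => le_rfl

lemma growthP_wt (hp : 1 ≤ p) : GrowthP p (wt p : Rd d → ℝ) :=
  growthP_of_le (continuous_wt hp) 1 fun y => by rw [abs_of_nonneg (wt_nonneg y), one_mul]

lemma GrowthP.add {f g : Rd d → ℝ} (hf : GrowthP p f) (hg : GrowthP p g) :
    GrowthP p (fun y => f y + g y) := by
  obtain ⟨hf, K, hK⟩ := hf
  obtain ⟨hg, L, hL⟩ := hg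
  refine ⟨hf.add hg, K + L, fun y => (abs_add_le _ _).trans ?_⟩
  rw [add_mul]
  exact add_le_add (hK y) (hL y)

lemma GrowthP.const_mul {f : Rd d → ℝ} (hf : GrowthP p f) (c : ℝ) :
    GrowthP p (fun y => c * f y) := by
  obtain ⟨hf, K, hK⟩ := hf
  refine ⟨continuous_const.mul hf, |c| * K, fun y => ?_⟩
  rw [abs_mul, mul_assoc]
  exact mul_le_mul_of_nonneg_left (hK y) (abs_nonneg _)

lemma GrowthP.sum {ι : Type*} (s : Finset ι) {f : ι → Rd d → ℝ} (hf : ∀ i, GrowthP p (f i)) :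
    GrowthP p (fun y => ∑ i ∈ s, f i y) := by
  classical
  induction s using Finset.induction_on with
  | empty => simpa using growthP_const 0
  | insert a s ha ih =>
    simp only [Finset.sum_insert ha]
    exact GrowthP.add (hf a) ih

lemma growthP_coord (hp : 1 ≤ p) (i : Fin d) : GrowthP p (fun y : Rd d => y i) := by
  refine growthP_of_le (by fun_prop) 1 fun y => ?_
  rw [one_mul]
  have h1 : |y i| ≤ ‖y‖ := PiLp.norm_apply_le y i
  refine h1.trans ?_
  unfold wt
  rcases le_total ‖y‖ 1 with h | h
  · have : 0 ≤ ‖y‖ ^ p := by positivity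
    linarith
  · have := Real.self_le_rpow_of_one_le h hp
    linarith

lemma growthP_norm (hp : 1 ≤ p) : GrowthP p (fun y : Rd d => ‖y‖) := by
  refine growthP_of_le (by fun_prop) 1 fun y => ?_
  rw [one_mul, abs_of_nonneg (norm_nonneg _)]
  unfold wt
  rcases le_total ‖y‖ 1 with h | h
  · have : 0 ≤ ‖y‖ ^ p := by positivity
    linarith
  · have := Real.self_le_rpow_of_one_le h hp
    linarith

lemma integrable_norm_rpow {ρ : Measure (Rd d)} (hp : 1 ≤ p) (h : HasMomentP p ρ) :
    Integrable (fun y => ‖y‖ ^ p) ρ := by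
  have hc : Continuous fun y : Rd d => ‖y‖ ^ p :=
    continuous_norm.rpow_const fun _ => Or.inr (by linarith)
  refine ⟨hc.aestronglyMeasurable, ?_⟩
  rw [hasFiniteIntegral_iff_ofReal (Eventually.of_forall fun y => by positivity)]
  exact lt_top_iff_ne_top.2 h

lemma hasMomentP_of_lintegral_wt {ρ : Measure (Rd d)}
    (h : ∫⁻ y, ENNReal.ofReal (wt p y) ∂ρ ≠ ⊤) : HasMomentP p ρ := by
  refine ne_top_of_le_ne_top h (lintegral_mono fun y => ENNReal.ofReal_le_ofReal ?_)
  unfold wt; linarith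

lemma GrowthP.integrable {f : Rd d → ℝ} (hf : GrowthP p f) (hp : 1 ≤ p) {ρ : Measure (Rd d)}
    [IsFiniteMeasure ρ] (hρ : HasMomentP p ρ) : Integrable f ρ := by
  obtain ⟨hf, K, hK⟩ := hf
  exact Integrable.mono' (((integrable_const (1 : ℝ)).add
    (integrable_norm_rpow hp hρ)).const_mul K) hf.aestronglyMeasurable (Eventually.of_forall hK)

lemma GrowthP.integrable' {f : Rd d → ℝ} (hf : GrowthP p f) (hp : 1 ≤ p) (ρ : Pp p d) :
    Integrable f ρ.1 := GrowthP.integrable hf hp ρ.2.2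

lemma continuous_integral_growthP {f : Rd d → ℝ} (hf : GrowthP p f) :
    Continuous fun ρ : Pp p d => ∫ y, f y ∂ρ.1 :=
  continuous_iInf_dom (i := (⟨f, hf⟩ : {f : Rd d → ℝ // GrowthP p f})) continuous_induced_dom

lemma lintegral_ofReal_growthP {f : Rd d → ℝ} (hf : GrowthP p f) (hp : 1 ≤ p) (h0 : ∀ y, 0 ≤ f y)
    (ρ : Pp p d) : ∫⁻ y, ENNReal.ofReal (f y) ∂ρ.1 = ENNReal.ofReal (∫ y, f y ∂ρ.1) :=
  (ofReal_integral_eq_lintegral_ofReal (GrowthP.integrable' hf hp ρ)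
    (Eventually.of_forall h0)).symm

lemma continuous_lintegral_growthP {f : Rd d → ℝ} (hf : GrowthP p f) (hp : 1 ≤ p)
    (h0 : ∀ y, 0 ≤ f y) : Continuous fun ρ : Pp p d => ∫⁻ y, ENNReal.ofReal (f y) ∂ρ.1 := by
  simp_rw [fun ρ : Pp p d => lintegral_ofReal_growthP hf hp h0 ρ]
  exact ENNReal.continuous_ofReal.comp (continuous_integral_growthP hf)

/-- Dirac masses as elements of `P_p`. -/
noncomputable def diracPp (p : ℝ) {d : ℕ} (y : Rd d) : Pp p d :=
  ⟨Measure.dirac y, inferInstance, by simp [HasMomentP]⟩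

instance nonempty_Pp : Nonempty (Pp p d) := ⟨diracPp p 0⟩

lemma lintegral_mix (t s : ℝ≥0∞) (ρ₁ ρ₂ : Measure (Rd d)) (f : Rd d → ℝ≥0∞) :
    ∫⁻ y, f y ∂(t • ρ₁ + s • ρ₂) = t * ∫⁻ y, f y ∂ρ₁ + s * ∫⁻ y, f y ∂ρ₂ := by
  rw [lintegral_add_measure, lintegral_smul_measure, lintegral_smul_measure, smul_eq_mul,
    smul_eq_mul]

/-- Mixtures of elements of `P_p`. -/
noncomputable def mix (t : ℝ≥0∞) (ht : t ≤ 1) (ρ₁ ρ₂ : Pp p d) : Pp p d :=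
  ⟨t • ρ₁.1 + (1 - t) • ρ₂.1, ⟨by simp [ht]⟩, by
    have h1 := ρ₁.2.2
    have h2 := ρ₂.2.2
    unfold HasMomentP at *
    rw [lintegral_mix]
    exact ENNReal.add_ne_top.2 ⟨ENNReal.mul_ne_top (ne_top_of_le_ne_top ENNReal.one_ne_top ht) h1,
      ENNReal.mul_ne_top (ne_top_of_le_ne_top ENNReal.one_ne_top tsub_le_self) h2⟩⟩

lemma integral_mix {t : ℝ≥0∞} (ht : t ≤ 1) (ρ₁ ρ₂ : Pp p d) {f : Rd d → ℝ} (hf : GrowthP p f)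
    (hp : 1 ≤ p) : ∫ y, f y ∂(mix t ht ρ₁ ρ₂).1 =
      t.toReal * ∫ y, f y ∂ρ₁.1 + (1 - t.toReal) * ∫ y, f y ∂ρ₂.1 := by
  have h1 := GrowthP.integrable' hf hp ρ₁
  have h2 := GrowthP.integrable' hf hp ρ₂
  have ht' : t ≠ ⊤ := ne_top_of_le_ne_top ENNReal.one_ne_top ht
  have hs' : 1 - t ≠ ⊤ := ne_top_of_le_ne_top ENNReal.one_ne_top tsub_le_self
  unfold mix
  rw [integral_add_measure (h1.smul_measure ht') (h2.smul_measure hs'), integral_smul_measure,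
    integral_smul_measure, ENNReal.toReal_sub_of_le ht ENNReal.one_ne_top]
  simp

/-! ### A countable family of test functions -/

/-- Cone-shaped bumps with rational height, integer slope and apex in a dense sequence. -/
noncomputable def bump (d : ℕ) (i : ℕ × ℚ × ℕ) (y : Rd d) : NNReal :=
  Real.toNNReal ((i.2.1 : ℝ) - i.2.2 * dist y (TopologicalSpace.denseSeq (Rd d) i.1))

lemma continuous_bump (i : ℕ × ℚ × ℕ) : Continuous (bump d i) := by
  unfold bump
  exact continuous_real_toNNReal.comp (by fun_prop)

lemma exists_bump_le {f : Rd d → NNReal} (hf : Continuous f) (y : Rd d) {c : NNReal}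
    (hc : c < f y) : ∃ i, (∀ z, bump d i z ≤ f z) ∧ c < bump d i y := by
  obtain ⟨q, hcq, hqf⟩ := exists_rat_btwn (NNReal.coe_lt_coe.2 hc)
  have hev : ∀ᶠ z in 𝓝 y, (q : ℝ) < f z :=
    (NNReal.continuous_coe.comp hf).continuousAt.eventually_const_lt hqf
  obtain ⟨r, hr, hball⟩ := Metric.eventually_nhds_iff_ball.1 hev
  obtain ⟨j, hj⟩ := exists_nat_gt (2 * q / r)
  have hη : 0 < min (r / 2) ((q - c) / (j + 1)) := by
    refine lt_min (by positivity) (div_pos (by linarith) (by positivity))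
  obtain ⟨n, hn⟩ := (TopologicalSpace.denseRange_denseSeq (Rd d)).exists_dist_lt y hη
  have h1 := hn.trans_le (min_le_left _ _)
  have h2 := hn.trans_le (min_le_right _ _)
  have hq : (0 : ℝ) < q := lt_of_le_of_lt c.2 hcq
  refine ⟨(n, q, j), fun z => ?_, ?_⟩
  · unfold bump
    rw [Real.toNNReal_le_iff_le_coe]
    by_cases hz : z ∈ Metric.ball y r
    · have := hball z hz
      have h3 : (0 : ℝ) ≤ j * dist z (TopologicalSpace.denseSeq (Rd d) n) := by positivity
      simp only
      linarith
    · have hz' : r ≤ dist z y := by simpa using hz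
      have h4 := dist_triangle_right z y (TopologicalSpace.denseSeq (Rd d) n)
      have h5 : r / 2 ≤ dist z (TopologicalSpace.denseSeq (Rd d) n) := by linarith
      have h6 : 2 * q < j * r := (div_lt_iff₀ hr).1 hj
      have h7 : (j : ℝ) * (r / 2) ≤ j * dist z (TopologicalSpace.denseSeq (Rd d) n) :=
        mul_le_mul_of_nonneg_left h5 (by positivity)
      have h8 : (0 : ℝ) ≤ f z := (f z).2
      simp only
      linarith
  · unfold bump
    rw [Real.lt_toNNReal_iff_coe_lt]
    rw [lt_div_iff₀ (by positivity)] at h2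
    have h9 : (0 : ℝ) ≤ dist y (TopologicalSpace.denseSeq (Rd d) n) := dist_nonneg
    simp only
    nlinarith

lemma exists_testFamily (d : ℕ) : ∃ g : ℕ → Rd d → NNReal, (∀ k, Continuous (g k)) ∧
    (∀ k, ∃ B : NNReal, ∀ y, g k y ≤ B) ∧
    ∀ f : Rd d → NNReal, Continuous f → ∃ s : ℕ → ℕ, Monotone (fun n => g (s n)) ∧
      (∀ n y, g (s n) y ≤ f y) ∧ ∀ y, ∀ c < f y, ∃ n, c < g (s n) y := by
  classical
  obtain ⟨e, he⟩ := exists_surjective_nat (Finset (ℕ × ℚ × ℕ))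
  refine ⟨fun k y => (e k).sup fun i => bump d i y, fun k => ?_, fun k => ?_, fun f hf => ?_⟩
  · exact Continuous.finset_sup_apply fun i _ => continuous_bump i
  · refine ⟨(e k).sup fun i => Real.toNNReal i.2.1, fun y => Finset.sup_mono_fun fun i _ => ?_⟩
    exact Real.toNNReal_le_toNNReal (sub_le_self _ (by positivity))
  · obtain ⟨a, ha⟩ := (to_countable {i | ∀ z, bump d i z ≤ f z}).exists_eq_range
      ⟨(0, 0, 0), fun z => by simp [bump]⟩
    choose s hs using fun n => he ((Finset.range n).image a)
    have hmem : ∀ n z, bump d (a n) z ≤ f z := fun n => by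
      have : a n ∈ {i | ∀ z, bump d i z ≤ f z} := ha ▸ mem_range_self n
      exact this
    refine ⟨s, fun m n hmn y => ?_, fun n y => ?_, fun y c hc => ?_⟩
    · simp only [hs]
      exact Finset.sup_mono (Finset.image_subset_image (Finset.range_mono hmn))
    · simp only [hs, Finset.sup_image]
      exact Finset.sup_le fun m _ => hmem m y
    · obtain ⟨i, hi, hic⟩ := exists_bump_le hf y hc
      obtain ⟨n, rfl⟩ : i ∈ range a := ha ▸ hi
      refine ⟨n + 1, hic.trans_le ?_⟩
      simp only [hs, Finset.sup_image]
      exact Finset.le_sup (f := fun m => bump d (a m) y) (Finset.self_mem_range_succ n)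

/-- A countable family of bounded continuous functions approximating every nonnegative
continuous function from below. -/
noncomputable def testFn (d : ℕ) : ℕ → Rd d → NNReal := (exists_testFamily d).choose

lemma continuous_testFn (k : ℕ) : Continuous (testFn d k) :=
  (exists_testFamily d).choose_spec.1 k

/-- A bound for `testFn d k`. -/
noncomputable def testBound (d k : ℕ) : NNReal := ((exists_testFamily d).choose_spec.2.1 k).choose

lemma testFn_le (k : ℕ) (y : Rd d) : testFn d k y ≤ testBound d k :=
  ((exists_testFamily d).choose_spec.2.1 k).choose_spec y

lemma exists_testFn_approx {f : Rd d → NNReal} (hf : Continuous f) :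
    ∃ s : ℕ → ℕ, Monotone (fun n => testFn d (s n)) ∧
      (∀ n y, testFn d (s n) y ≤ f y) ∧ ∀ y, ∀ c < f y, ∃ n, c < testFn d (s n) y :=
  (exists_testFamily d).choose_spec.2.2 f hf

lemma exists_lintegral_eq_iSup_testFn {f : Rd d → NNReal} (hf : Continuous f) :
    ∃ s : ℕ → ℕ, (∀ n y, testFn d (s n) y ≤ f y) ∧
      ∀ ρ : Measure (Rd d), ∫⁻ y, f y ∂ρ = ⨆ n, ∫⁻ y, testFn d (s n) y ∂ρ := by
  obtain ⟨s, hs, hle, hlt⟩ := exists_testFn_approx hf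
  refine ⟨s, hle, fun ρ => ?_⟩
  rw [← lintegral_iSup (fun n => (continuous_testFn _).measurable.coe_nnreal_ennreal)
    (fun m n hmn y => by simpa using hs hmn y)]
  refine lintegral_congr fun y => le_antisymm (le_of_forall_lt fun c hc => ?_)
    (iSup_le fun n => by simpa using hle n y)
  lift c to NNReal using hc.ne_top
  obtain ⟨n, hn⟩ := hlt y c (by simpa using hc)
  exact lt_iSup_iff.2 ⟨n, by simpa using hn⟩

lemma growthP_testFn (k : ℕ) : GrowthP p (fun y : Rd d => (testFn d k y : ℝ)) :=
  growthP_of_bounded (NNReal.continuous_coe.comp (continuous_testFn k)) (testBound d k) fun y => by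
    simpa using testFn_le k y

/-- The integral of a test function. -/
noncomputable def coord (k : ℕ) (ρ : Pp p d) : ℝ := ∫ y, (testFn d k y : ℝ) ∂ρ.1

lemma continuous_coord (k : ℕ) : Continuous (coord k : Pp p d → ℝ) :=
  continuous_integral_growthP (growthP_testFn k)

lemma coord_nonneg (k : ℕ) (ρ : Pp p d) : 0 ≤ coord k ρ := integral_nonneg fun _ => NNReal.coe_nonneg _

lemma coord_le (k : ℕ) (ρ : Pp p d) : coord k ρ ≤ testBound d k := by
  have h : coord k ρ ≤ ∫ _, (testBound d k : ℝ) ∂ρ.1 :=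
    integral_mono_of_nonneg (Eventually.of_forall fun _ => NNReal.coe_nonneg _)
      (integrable_const _) (Eventually.of_forall fun y => testFn_le k y)
  simpa using h

lemma lintegral_testFn (hp : 1 ≤ p) (k : ℕ) (ρ : Pp p d) :
    ∫⁻ y, testFn d k y ∂ρ.1 = ENNReal.ofReal (coord k ρ) := by
  rw [coord, ← lintegral_ofReal_growthP (growthP_testFn k) hp (fun _ => NNReal.coe_nonneg _)]
  simp

lemma measure_eq_of_testFn {ρ₁ ρ₂ : Measure (Rd d)} [IsFiniteMeasure ρ₁] [IsFiniteMeasure ρ₂]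
    (h : ∀ k, ∫⁻ y, testFn d k y ∂ρ₁ = ∫⁻ y, testFn d k y ∂ρ₂) : ρ₁ = ρ₂ := by
  refine ext_of_forall_lintegral_eq_of_IsFiniteMeasure fun f => ?_
  obtain ⟨s, -, hs⟩ := exists_lintegral_eq_iSup_testFn f.continuous
  rw [hs, hs]
  simp_rw [h]

lemma eq_of_coord_eq (hp : 1 ≤ p) {ρ₁ ρ₂ : Pp p d} (h : ∀ k, coord k ρ₁ = coord k ρ₂) :
    ρ₁ = ρ₂ :=
  Subtype.ext <| measure_eq_of_testFn fun k => by
    rw [lintegral_testFn hp, lintegral_testFn hp, h]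

/-! ### The topology and the Borel structure of `P_p` -/

lemma eventually_lt_integral {ι : Type*} {L : Filter ι} {ρs : ι → Pp p d} {ρ : Pp p d}
    (hp : 1 ≤ p) (hk : ∀ k, Tendsto (fun i => coord k (ρs i)) L (𝓝 (coord k ρ)))
    {f : Rd d → ℝ} (hf : GrowthP p f) (h0 : ∀ y, 0 ≤ f y) {c : ℝ} (hc : c < ∫ y, f y ∂ρ.1) :
    ∀ᶠ i in L, c < ∫ y, f y ∂(ρs i).1 := by
  rcases lt_or_ge c 0 with hc0 | hc0
  · exact Eventually.of_forall fun i => hc0.trans_le (integral_nonneg h0)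
  obtain ⟨s, hle, hs⟩ := exists_lintegral_eq_iSup_testFn (f := fun y => (f y).toNNReal)
    (continuous_real_toNNReal.comp hf.1)
  have key : ∀ σ : Pp p d, ENNReal.ofReal (∫ y, f y ∂σ.1)
      = ⨆ n, ENNReal.ofReal (coord (s n) σ) := fun σ => by
    rw [← lintegral_ofReal_growthP hf hp h0]
    simp_rw [← lintegral_testFn hp]
    exact hs σ.1
  have h1 : ENNReal.ofReal c < ⨆ n, ENNReal.ofReal (coord (s n) ρ) := by
    rw [← key]
    exact (ENNReal.ofReal_lt_ofReal_iff_of_nonneg hc0).2 hc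
  obtain ⟨n, hn⟩ := lt_iSup_iff.1 h1
  filter_upwards [(hk (s n)).eventually_const_lt
    ((ENNReal.ofReal_lt_ofReal_iff_of_nonneg hc0).1 hn)] with i hi
  refine (ENNReal.ofReal_lt_ofReal_iff_of_nonneg hc0).1 ?_
  rw [key]
  exact lt_iSup_iff.2 ⟨n, (ENNReal.ofReal_lt_ofReal_iff_of_nonneg hc0).2 hi⟩

lemma tendsto_of_coord {ι : Type*} {L : Filter ι} {ρs : ι → Pp p d} {ρ : Pp p d}
    (hp : 1 ≤ p) (hk : ∀ k, Tendsto (fun i => coord k (ρs i)) L (𝓝 (coord k ρ)))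
    (hw : Tendsto (fun i => ∫ y, wt p y ∂(ρs i).1) L (𝓝 (∫ y, wt p y ∂ρ.1))) :
    Tendsto ρs L (𝓝 ρ) := by
  have main : ∀ f : Rd d → ℝ, GrowthP p f → ∀ c < ∫ y, f y ∂ρ.1,
      ∀ᶠ i in L, c < ∫ y, f y ∂(ρs i).1 := by
    intro f hf c hc
    obtain ⟨K, hK⟩ := hf.2
    have hg : GrowthP p (fun y => f y + K * wt p y) :=
      GrowthP.add hf (GrowthP.const_mul (growthP_wt hp) K)
    have hint : ∀ σ : Pp p d, ∫ y, (f y + K * wt p y) ∂σ.1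
        = ∫ y, f y ∂σ.1 + K * ∫ y, wt p y ∂σ.1 := fun σ => by
      rw [integral_add (GrowthP.integrable' hf hp σ)
        ((GrowthP.integrable' (growthP_wt hp) hp σ).const_mul K), integral_const_mul]
    set η := (∫ y, f y ∂ρ.1 - c) / 2 with hη
    have h1 := eventually_lt_integral hp hk hg
      (fun y => by have := neg_abs_le (f y); have := hK y; unfold wt; linarith)
      (c := ∫ y, (f y + K * wt p y) ∂ρ.1 - η) (by linarith)
    have h2 := (hw.const_mul K).eventually_lt_const
      (u := K * (∫ y, wt p y ∂ρ.1) + η) (by linarith)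
    filter_upwards [h1, h2] with i h1 h2
    rw [hint, hint] at h1
    linarith
  rw [nhds_iInf, tendsto_iInf]
  rintro ⟨f, hf⟩
  rw [nhds_induced, tendsto_comap_iff]
  refine tendsto_order.2 ⟨fun c hc => main f hf c hc, fun c hc => ?_⟩
  have h := main (fun y => (-1) * f y) (GrowthP.const_mul hf (-1)) (-c)
    (by rw [integral_const_mul]; simp only at hc; linarith)
  filter_upwards [h] with i hi
  rw [integral_const_mul] at hi
  simp only [Function.comp_apply]
  linarith

/-- Coordinates determining the topology of `P_p`. -/
noncomputable def coords (ρ : Pp p d) : (ℕ → ℝ) × ℝ := (fun k => coord k ρ, ∫ y, wt p y ∂ρ.1)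

lemma isInducing_coords (hp : 1 ≤ p) : IsInducing (coords : Pp p d → (ℕ → ℝ) × ℝ) := by
  have hcont : Continuous (coords : Pp p d → (ℕ → ℝ) × ℝ) :=
    (continuous_pi continuous_coord).prodMk (continuous_integral_growthP (growthP_wt hp))
  refine isInducing_iff_nhds.2 fun ρ => le_antisymm (hcont.tendsto ρ).le_comap ?_
  have h : Tendsto (coords : Pp p d → (ℕ → ℝ) × ℝ) (comap coords (𝓝 (coords ρ)))
    (𝓝 (coords ρ)) := tendsto_comap
  refine tendsto_id'.1 (tendsto_of_coord (ρs := id) hp (fun k => ?_) ?_)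
  · exact (((continuous_apply k).comp continuous_fst).tendsto _).comp h
  · exact (continuous_snd.tendsto _).comp h

lemma secondCountable_Pp (hp : 1 ≤ p) : SecondCountableTopology (Pp p d) :=
  (isInducing_coords hp).secondCountableTopology

instance borelSpace_Pp : BorelSpace (Pp p d) := ⟨rfl⟩

lemma integral_wt_eq (hp : 1 ≤ p) : ∃ s : ℕ → ℕ, ∀ ρ : Pp p d,
    ∫ y, wt p y ∂ρ.1 = (⨆ n, ENNReal.ofReal (coord (s n) ρ)).toReal := by
  obtain ⟨s, -, hs⟩ := exists_lintegral_eq_iSup_testFn (f := fun y : Rd d => (wt p y).toNNReal)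
    (continuous_real_toNNReal.comp (continuous_wt hp))
  refine ⟨s, fun ρ => ?_⟩
  simp_rw [← lintegral_testFn hp]
  rw [← hs, integral_eq_lintegral_of_nonneg_ae (Eventually.of_forall wt_nonneg)
    (continuous_wt hp).aestronglyMeasurable]
  rfl

lemma measurable_of_coord {X : Type*} [MeasurableSpace X] (hp : 1 ≤ p) {κ : X → Pp p d}
    (h : ∀ k, Measurable fun x => coord k (κ x)) : Measurable κ := by
  obtain ⟨s, hs⟩ := integral_wt_eq (d := d) hp
  have h2 : Measurable fun x => coords (κ x) := by
    refine Measurable.prodMk (measurable_pi_lambda _ h) ?_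
    simp_rw [hs]
    exact (Measurable.iSup fun n => (h (s n)).ennreal_ofReal).ennreal_toReal
  have hb : PpMeasurableSpace p d = MeasurableSpace.comap coords inferInstance := by
    change @borel _ (PpTopology p d) = _
    rw [(isInducing_coords hp).eq_induced, borel_comap, ← BorelSpace.measurable_eq]
  rw [hb, measurable_comap_iff]
  exact h2

lemma measurable_integral_comp {X : Type*} [MeasurableSpace X] {κ : X → Pp p d}
    (h : Measurable κ) {f : Rd d → ℝ} (hf : GrowthP p f) :
    Measurable fun x => ∫ y, f y ∂(κ x).1 :=
  (continuous_integral_growthP hf).measurable.comp h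

lemma measurable_coe_measure (hp : 1 ≤ p) :
    Measurable (fun ρ : Pp p d => (ρ.1 : Measure (Rd d))) := by
  refine Measurable.measure_of_isPiSystem_of_isProbabilityMeasure
    (S := {s | IsOpen s}) BorelSpace.measurable_eq isPiSystem_isOpen fun U hU => ?_
  replace hU : IsOpen U := by simpa using hU
  have hc : IsClosed Uᶜ := hU.isClosed_compl
  have h1 : ∀ ρ : Pp p d, ρ.1 U = 1 - ρ.1 Uᶜ := fun ρ => by
    rw [prob_compl_eq_one_sub hU.measurableSet, ENNReal.sub_sub_cancel ENNReal.one_ne_top prob_le_one]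
  simp_rw [h1]
  refine measurable_const.sub ?_
  refine measurable_of_tendsto_metrizable (f := fun (n : ℕ) (ρ : Pp p d) =>
    ∫⁻ y, (hc.apprSeq n y : ℝ≥0∞) ∂ρ.1) (fun n => ?_) ?_
  · have hg : GrowthP p fun y : Rd d => (hc.apprSeq n y : ℝ) :=
      growthP_of_bounded (NNReal.continuous_coe.comp (hc.apprSeq n).continuous) 1 fun y => by
        simpa using HasOuterApproxClosed.apprSeq_apply_le_one hc n y
    have := (continuous_lintegral_growthP hg hp fun y => NNReal.coe_nonneg _).measurable
    simpa using this
  · exact tendsto_pi_nhds.2 fun ρ => HasOuterApproxClosed.tendsto_lintegral_apprSeq hc ρ.1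

end WeakTransport

namespace WeakTransport

variable {p : ℝ} {d : ℕ}

/-- The mass of the weight above level `r`. -/
noncomputable def tail (r : ℝ) (ρ : Pp p d) : ℝ≥0∞ := ∫⁻ y, ENNReal.ofReal (wt p y - r) ∂ρ.1

/-- Partial sums of the tails at the levels `R j`. -/
noncomputable def tailSum (R : ℕ → ℝ) (m : ℕ) (ρ : Pp p d) : ℝ≥0∞ :=
  ∑ j ∈ Finset.range m, tail (R j) ρ

/-- The sum of the tails at the levels `R j`. -/
noncomputable def tailSeries (R : ℕ → ℝ) (ρ : Pp p d) : ℝ≥0∞ := ⨆ m, tailSum R m ρ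

lemma growthP_pos_wt_sub (hp : 1 ≤ p) (r : ℝ) :
    GrowthP p fun y : Rd d => max (wt p y - r) 0 := by
  refine growthP_of_le (((continuous_wt hp).sub continuous_const).max continuous_const) (1 + |r|)
    fun y => ?_
  rw [abs_of_nonneg (le_max_right _ _)]
  have := one_le_wt (p := p) y
  have h2 := neg_abs_le r
  have h3 : |r| ≤ |r| * wt p y := le_mul_of_one_le_right (abs_nonneg r) this
  refine max_le ?_ ?_
  · linarith
  · nlinarith [abs_nonneg r]

lemma ofReal_max_wt_sub (r : ℝ) (y : Rd d) :
    ENNReal.ofReal (max (wt p y - r) 0) = ENNReal.ofReal (wt p y - r) := by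
  rcases le_total (wt p y - r) 0 with h | h
  · rw [max_eq_right h, ENNReal.ofReal_of_nonpos h, ENNReal.ofReal_zero]
  · rw [max_eq_left h]

lemma tail_eq (hp : 1 ≤ p) (r : ℝ) (ρ : Pp p d) :
    tail r ρ = ENNReal.ofReal (∫ y, max (wt p y - r) 0 ∂ρ.1) := by
  rw [← lintegral_ofReal_growthP (growthP_pos_wt_sub hp r) hp fun y => le_max_right _ _]
  simp_rw [ofReal_max_wt_sub]
  rfl

lemma continuous_tail (hp : 1 ≤ p) (r : ℝ) : Continuous (tail r : Pp p d → ℝ≥0∞) := by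
  have := continuous_lintegral_growthP (d := d) (growthP_pos_wt_sub hp r) hp
    fun y => le_max_right _ _
  simp_rw [ofReal_max_wt_sub] at this
  exact this

lemma tail_anti {r s : ℝ} (h : r ≤ s) (ρ : Pp p d) : tail s ρ ≤ tail r ρ :=
  lintegral_mono fun _ => ENNReal.ofReal_le_ofReal (by linarith)

lemma continuous_tailSum (hp : 1 ≤ p) (R : ℕ → ℝ) (m : ℕ) :
    Continuous (tailSum R m : Pp p d → ℝ≥0∞) :=
  continuous_finsetSum _ fun _ _ => continuous_tail hp _

lemma tailSum_mono (R : ℕ → ℝ) (ρ : Pp p d) : Monotone fun m => tailSum R m ρ := fun _ _ h =>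
  Finset.sum_le_sum_of_subset (Finset.range_mono h)

lemma tailSum_le_tailSeries (R : ℕ → ℝ) (m : ℕ) (ρ : Pp p d) : tailSum R m ρ ≤ tailSeries R ρ :=
  le_iSup (fun m => tailSum R m ρ) m

lemma tailSeries_eq_tsum (R : ℕ → ℝ) (ρ : Pp p d) : tailSeries R ρ = ∑' j, tail (R j) ρ :=
  ENNReal.tsum_eq_iSup_nat.symm

lemma lowerSemicontinuous_tailSeries (hp : 1 ≤ p) (R : ℕ → ℝ) :
    LowerSemicontinuous (tailSeries R : Pp p d → ℝ≥0∞) :=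
  lowerSemicontinuous_iSup fun m => (continuous_tailSum hp R m).lowerSemicontinuous

lemma tail_mix {t : ℝ≥0∞} (ht : t ≤ 1) (r : ℝ) (ρ₁ ρ₂ : Pp p d) :
    tail r (mix t ht ρ₁ ρ₂) = t * tail r ρ₁ + (1 - t) * tail r ρ₂ :=
  lintegral_mix _ _ _ _ _

lemma tailSeries_mix {t : ℝ≥0∞} (ht : t ≤ 1) (R : ℕ → ℝ) (ρ₁ ρ₂ : Pp p d) :
    tailSeries R (mix t ht ρ₁ ρ₂) = t * tailSeries R ρ₁ + (1 - t) * tailSeries R ρ₂ := by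
  simp_rw [tailSeries_eq_tsum, tail_mix, ENNReal.tsum_add, ENNReal.tsum_mul_left]

lemma lintegral_wt_ne_top (hp : 1 ≤ p) (ρ : Pp p d) :
    ∫⁻ y, ENNReal.ofReal (wt p y) ∂ρ.1 ≠ ⊤ := by
  rw [lintegral_ofReal_growthP (growthP_wt hp) hp wt_nonneg]
  exact ENNReal.ofReal_ne_top

lemma tendsto_tail (hp : 1 ≤ p) (ρ : Pp p d) : Tendsto (fun n : ℕ => tail (n : ℝ) ρ) atTop (𝓝 0) := by
  have h := tendsto_lintegral_of_dominated_convergence (μ := ρ.1)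
    (F := fun (n : ℕ) (y : Rd d) => ENNReal.ofReal (wt p y - n)) (f := fun _ => 0)
    (fun y => ENNReal.ofReal (wt p y))
    (fun n => (((continuous_wt hp).sub continuous_const).measurable).ennreal_ofReal)
    (fun n => Eventually.of_forall fun y => ENNReal.ofReal_le_ofReal (by simp))
    (lintegral_wt_ne_top hp ρ) (Eventually.of_forall fun y => by
      obtain ⟨N, hN⟩ := exists_nat_ge (wt p y)
      refine tendsto_const_nhds.congr' ?_
      filter_upwards [eventually_ge_atTop N] with n hn
      rw [ENNReal.ofReal_of_nonpos]
      have : (N : ℝ) ≤ n := by exact_mod_cast hn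
      linarith)
  simpa [tail] using h

lemma exists_levels (hp : 1 ≤ p) (ρ : Pp p d) : ∃ R : ℕ → ℝ, Monotone R ∧ (∀ j : ℕ, (j : ℝ) ≤ R j) ∧
    tailSeries R ρ ≤ 1 := by
  obtain ⟨δ, hδ, hsum⟩ := ENNReal.exists_pos_sum_of_countable one_ne_zero ℕ
  have h : ∀ j : ℕ, ∃ N : ℕ, j ≤ N ∧ tail (N : ℝ) ρ ≤ δ j := fun j => by
    have h1 := (tendsto_tail hp ρ).eventually_le_const
      (u := (δ j : ℝ≥0∞)) (ENNReal.coe_pos.2 (hδ j))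
    exact ((eventually_ge_atTop j).and h1).exists
  choose N hN1 hN2 using h
  refine ⟨fun j => ((∑ i ∈ Finset.range (j + 1), N i : ℕ) : ℝ), fun i j hij => ?_, fun j => ?_, ?_⟩
  · have : i + 1 ≤ j + 1 := by lia
    exact Nat.cast_le.2 (Finset.sum_le_sum_of_subset (Finset.range_mono this))
  · exact Nat.cast_le.2 <| (hN1 j).trans
      (Finset.single_le_sum (f := N) (fun _ _ => Nat.zero_le _) (Finset.mem_range.2 (Nat.lt_succ_self j)))
  · rw [tailSeries_eq_tsum]
    refine (ENNReal.tsum_le_tsum fun j => (tail_anti ?_ ρ).trans (hN2 j)).trans hsum.le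
    exact_mod_cast Finset.single_le_sum (f := N) (fun _ _ => Nat.zero_le _)
      (Finset.mem_range.2 (Nat.lt_succ_self j))

lemma lintegral_wt_le (r : ℝ) (ρ : Pp p d) :
    ∫⁻ y, ENNReal.ofReal (wt p y) ∂ρ.1 ≤ ENNReal.ofReal r + tail r ρ := by
  have h : ∫⁻ y, ENNReal.ofReal (wt p y) ∂ρ.1
      ≤ ∫⁻ y, (ENNReal.ofReal r + ENNReal.ofReal (wt p y - r)) ∂ρ.1 :=
    lintegral_mono fun y => (ENNReal.ofReal_le_ofReal (by linarith)).trans ENNReal.ofReal_add_le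
  refine h.trans_eq ?_
  rw [lintegral_add_left measurable_const]
  simp [tail]

lemma mul_tail_le {R : ℕ → ℝ} (hR : Monotone R) {m n : ℕ} (hmn : m ≤ n) (ρ : Pp p d) :
    (m : ℝ≥0∞) * tail (R m) ρ ≤ tailSum R n ρ := by
  refine le_trans ?_ (tailSum_mono R ρ hmn)
  rw [← nsmul_eq_mul]
  refine (Finset.card_nsmul_le_sum (Finset.range m) _ _ fun j hj =>
    tail_anti (hR (Finset.mem_range.1 hj).le) ρ).trans' ?_
  simp

lemma isTight_of_lintegral_wt_le (hp : 1 ≤ p) {ρs : ℕ → Pp p d} {B : ℝ≥0∞} (hB : B ≠ ⊤)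
    (h : ∀ n, ∫⁻ y, ENNReal.ofReal (wt p y) ∂(ρs n).1 ≤ B) :
    IsTightMeasureSet {x : Measure (Rd d) | ∃ n, x = (ρs n).1} := by
  rw [isTightMeasureSet_iff_exists_isCompact_measure_compl_le]
  intro ε hε
  obtain ⟨r, hr0, hr⟩ : ∃ r : ℕ, 1 ≤ r ∧ B / r ≤ ε := by
    have h1 : Tendsto (fun n : ℕ => B / n) atTop (𝓝 0) := by
      have := ENNReal.Tendsto.const_mul (a := B) ENNReal.tendsto_inv_nat_nhds_zero (Or.inr hB)
      simpa [div_eq_mul_inv] using this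
    exact ((eventually_ge_atTop 1).and (h1.eventually_le_const hε)).exists
  refine ⟨Metric.closedBall 0 r, isCompact_closedBall _ _, ?_⟩
  rintro _ ⟨n, rfl⟩
  refine le_trans ?_ hr
  have h2 := meas_ge_le_lintegral_div (μ := (ρs n).1) (f := fun y => ENNReal.ofReal (wt p y))
    (continuous_wt hp).measurable.ennreal_ofReal.aemeasurable (ε := (r : ℝ≥0∞))
    (by simp; lia) (by simp)
  refine le_trans (measure_mono fun y hy => ?_) (h2.trans (ENNReal.div_le_div_right (h n) _))
  simp only [mem_compl_iff, Metric.mem_closedBall, dist_zero_right, not_le] at hy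
  have h3 : (1 : ℝ) ≤ ‖y‖ := by
    have : (1 : ℝ) ≤ r := by exact_mod_cast hr0
    linarith
  have h4 : ‖y‖ ≤ ‖y‖ ^ p := by simpa using Real.rpow_le_rpow_of_exponent_le h3 hp
  have h5 : (r : ℝ) ≤ wt p y := by unfold wt; linarith
  simp only [mem_ofPred_eq]
  rw [← ENNReal.ofReal_natCast]
  exact ENNReal.ofReal_le_ofReal h5

lemma exists_tendsto_coord (hp : 1 ≤ p) {ρs : ℕ → Pp p d} {B : ℝ≥0∞} (hB : B ≠ ⊤)
    (h : ∀ n, ∫⁻ y, ENNReal.ofReal (wt p y) ∂(ρs n).1 ≤ B) :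
    ∃ (ρ : Pp p d) (φ : ℕ → ℕ), StrictMono φ ∧
      ∀ k, Tendsto (fun n => coord k (ρs (φ n))) atTop (𝓝 (coord k ρ)) := by
  let P : ℕ → ProbabilityMeasure (Rd d) := fun n => ⟨(ρs n).1, inferInstance⟩
  have hcomp : IsCompact (closure (range P)) := by
    refine isCompact_closure_of_isTightMeasureSet ?_
    refine (isTight_of_lintegral_wt_le hp hB h).subset ?_
    rintro _ ⟨_, ⟨n, rfl⟩, rfl⟩
    exact ⟨n, rfl⟩
  obtain ⟨Q, -, φ, hφ, hlim⟩ := hcomp.tendsto_subseq fun n => subset_closure (mem_range_self n)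
  have hk : ∀ k, Tendsto (fun n => coord k (ρs (φ n))) atTop
      (𝓝 (∫ y, (testFn d k y : ℝ) ∂(Q : Measure (Rd d)))) := fun k => by
    have := ProbabilityMeasure.tendsto_iff_forall_integral_tendsto.1 hlim
      (BoundedContinuousFunction.ofNormedAddCommGroup (fun y => (testFn d k y : ℝ))
        (NNReal.continuous_coe.comp (continuous_testFn k)) (testBound d k) fun y => by
          simpa using testFn_le k y)
    exact this
  have hmom : HasMomentP p (Q : Measure (Rd d)) := by
    refine hasMomentP_of_lintegral_wt (ne_top_of_le_ne_top hB ?_)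
    obtain ⟨s, hle, hs⟩ := exists_lintegral_eq_iSup_testFn (f := fun y : Rd d => (wt p y).toNNReal)
      (continuous_real_toNNReal.comp (continuous_wt hp))
    change ∫⁻ y, ((wt p y).toNNReal : ℝ≥0∞) ∂(Q : Measure (Rd d)) ≤ B
    rw [hs]
    refine iSup_le fun n => ?_
    have e : ∫⁻ y, (testFn d (s n) y : ℝ≥0∞) ∂(Q : Measure (Rd d))
        = ENNReal.ofReal (∫ y, (testFn d (s n) y : ℝ) ∂(Q : Measure (Rd d))) := by
      rw [ofReal_integral_eq_lintegral_ofReal]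
      · simp
      · refine Integrable.of_bound (C := testBound d (s n)) ?_ (Eventually.of_forall fun y => ?_)
        · exact (NNReal.continuous_coe.comp (continuous_testFn _)).aestronglyMeasurable
        · simpa using testFn_le (s n) y
      · exact Eventually.of_forall fun y => NNReal.coe_nonneg _
    rw [e]
    refine le_of_tendsto (ENNReal.tendsto_ofReal (hk (s n))) (Eventually.of_forall fun i => ?_)
    rw [← lintegral_testFn hp]
    refine le_trans ?_ (h (φ i))
    refine (le_iSup (fun n => ∫⁻ y, (testFn d (s n) y : ℝ≥0∞) ∂(ρs (φ i)).1) n).trans ?_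
    rw [← hs]
    rfl
  exact ⟨⟨Q, inferInstance, hmom⟩, φ, hφ, hk⟩

lemma integral_wt_le_add (hp : 1 ≤ p) (r : ℝ) (ρ : Pp p d) :
    ∫ y, wt p y ∂ρ.1 = r - ∫ y, max (r - wt p y) 0 ∂ρ.1 + (tail r ρ).toReal := by
  have hg : GrowthP p fun y : Rd d => max (r - wt p y) 0 := by
    refine growthP_of_bounded ((continuous_const.sub (continuous_wt hp)).max continuous_const)
      |r| fun y => ?_
    rw [abs_of_nonneg (le_max_right _ _)]
    exact max_le (by linarith [wt_nonneg (p := p) y, le_abs_self r]) (abs_nonneg r)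
  rw [tail_eq hp, ENNReal.toReal_ofReal (integral_nonneg fun y => by exact le_max_right _ _)]
  have h : ∀ y : Rd d, wt p y = r - max (r - wt p y) 0 + max (wt p y - r) 0 := fun y => by
    rcases le_total (wt p y) r with h | h
    · rw [max_eq_left (by linarith), max_eq_right (by linarith)]; ring
    · rw [max_eq_right (by linarith), max_eq_left (by linarith)]; ring
  have i1 := GrowthP.integrable' hg hp ρ
  have i2 := GrowthP.integrable' (growthP_pos_wt_sub hp r) hp ρ
  conv_lhs => rw [integral_congr_ae (Eventually.of_forall h)]
  have i3 : Integrable (fun y : Rd d => r - max (r - wt p y) 0) ρ.1 := (integrable_const r).sub i1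
  rw [integral_add i3 i2, integral_sub (integrable_const r) i1]
  simp

lemma exists_tendsto_of_tailSum_le (hp : 1 ≤ p) {R : ℕ → ℝ} (hR : Monotone R)
    {ρs : ℕ → Pp p d} {M : ℝ≥0∞} (hM : M ≠ ⊤) (h : ∀ m, tailSum R m (ρs m) ≤ M) :
    ∃ (ρ : Pp p d) (φ : ℕ → ℕ), StrictMono φ ∧ Tendsto (ρs ∘ φ) atTop (𝓝 ρ) := by
  have htail : ∀ m n : ℕ, 1 ≤ m → m ≤ n → tail (R m) (ρs n) ≤ M / m := fun m n h1 h2 => by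
    rw [ENNReal.le_div_iff_mul_le (Or.inl (by simp; lia)) (Or.inl (by simp)), mul_comm]
    exact (mul_tail_le hR h2 _).trans (h n)
  have hB : ∀ n, ∫⁻ y, ENNReal.ofReal (wt p y) ∂(ρs (n + 1)).1 ≤ ENNReal.ofReal (R 1) + M :=
    fun n => (lintegral_wt_le (R 1) _).trans (add_le_add_right
      ((htail 1 (n + 1) le_rfl (by lia)).trans_eq (by simp)) _)
  obtain ⟨ρ, φ, hφ, hk⟩ := exists_tendsto_coord hp (ρs := fun n => ρs (n + 1))
    (ENNReal.add_ne_top.2 ⟨ENNReal.ofReal_ne_top, hM⟩) hB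
  refine ⟨ρ, fun n => φ n + 1, fun a b hab => by simpa using hφ hab, tendsto_of_coord hp hk ?_⟩
  refine tendsto_order.2 ⟨fun c hc => eventually_lt_integral hp hk (growthP_wt hp) wt_nonneg hc,
    fun c hc => ?_⟩
  set η := c - ∫ y, wt p y ∂ρ.1 with hη
  have hη0 : 0 < η := sub_pos.2 hc
  obtain ⟨m, hm1, hm⟩ : ∃ m : ℕ, 1 ≤ m ∧ M / m < ENNReal.ofReal (η / 2) := by
    have h1 : Tendsto (fun n : ℕ => M / n) atTop (𝓝 0) := by
      have := ENNReal.Tendsto.const_mul (a := M) ENNReal.tendsto_inv_nat_nhds_zero (Or.inr hM)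
      simpa [div_eq_mul_inv] using this
    exact ((eventually_ge_atTop 1).and
      (h1.eventually_lt_const (ENNReal.ofReal_pos.2 (half_pos hη0)))).exists
  have hg : GrowthP p fun y : Rd d => max (R m - wt p y) 0 := by
    refine growthP_of_bounded ((continuous_const.sub (continuous_wt hp)).max continuous_const)
      |R m| fun y => ?_
    rw [abs_of_nonneg (le_max_right _ _)]
    exact max_le (by linarith [wt_nonneg (p := p) y, le_abs_self (R m)]) (abs_nonneg _)
  have h3 := eventually_lt_integral hp hk hg (fun y => le_max_right _ _)
    (c := ∫ y, max (R m - wt p y) 0 ∂ρ.1 - η / 2) (by linarith)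
  filter_upwards [h3, eventually_ge_atTop m] with i hi him
  have h4 : (tail (R m) (ρs (φ i + 1))).toReal < η / 2 :=
    (ENNReal.lt_ofReal_iff_toReal_lt (ne_top_of_le_ne_top (ENNReal.div_ne_top hM (by simp; lia))
      (htail m _ hm1 (by have := hφ.id_le i; simp at this; lia)))).1
      ((htail m _ hm1 (by have := hφ.id_le i; simp at this; lia)).trans_lt hm)
  have h5 := integral_wt_le_add hp (R m) ρ
  have h6 := integral_wt_le_add hp (R m) (ρs (φ i + 1))
  have h7 : 0 ≤ (tail (R m) ρ).toReal := ENNReal.toReal_nonneg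
  simp only [Function.comp_apply]
  linarith

lemma exists_subseq_of_le {X : Type*} [TopologicalSpace X] (hp : 1 ≤ p) {R : ℕ → ℝ}
    (hR : Monotone R) {Q : X × Pp p d → ℝ≥0∞} (hQ : LowerSemicontinuous Q) {ε : ℝ≥0∞}
    (hε : ε ≠ 0) (hε' : ε ≠ ⊤) {xs : ℕ → X} {x : X} (hx : Tendsto xs atTop (𝓝 x))
    {ρs : ℕ → Pp p d} {c : ℝ≥0∞} (hc : c ≠ ⊤)
    (h : ∀ m, Q (xs m, ρs m) + ε * tailSum R m (ρs m) ≤ c) :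
    ∃ (ρ : Pp p d) (φ : ℕ → ℕ), StrictMono φ ∧ Tendsto (ρs ∘ φ) atTop (𝓝 ρ) ∧
      Q (x, ρ) + ε * tailSeries R ρ ≤ c := by
  obtain ⟨ρ, φ, hφ, hlim⟩ := exists_tendsto_of_tailSum_le hp hR (M := c / ε)
    (ENNReal.div_ne_top hc hε) (ρs := ρs) fun m => by
      rw [ENNReal.le_div_iff_mul_le (Or.inl hε) (Or.inl hε'), mul_comm]
      exact le_add_self.trans (h m)
  refine ⟨ρ, φ, hφ, hlim, ?_⟩
  rw [tailSeries, ENNReal.mul_iSup, ENNReal.add_iSup]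
  refine iSup_le fun k => ?_
  have hl : LowerSemicontinuous fun q : X × Pp p d => Q q + ε * tailSum R k q.2 :=
    hQ.add ((ENNReal.continuous_const_mul hε').comp
      ((continuous_tailSum hp R k).comp continuous_snd)).lowerSemicontinuous
  change (x, ρ) ∈ (fun q : X × Pp p d => Q q + ε * tailSum R k q.2) ⁻¹' Iic c
  refine (hl.isClosed_preimage c).mem_of_tendsto
    (b := atTop) (f := fun n => (xs (φ n), ρs (φ n))) ?_ ?_
  · exact ((hx.comp hφ.tendsto_atTop).prodMk_nhds hlim)
  · filter_upwards [eventually_ge_atTop k] with n hn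
    refine le_trans ?_ (h (φ n))
    have : k ≤ φ n := hn.trans (hφ.id_le n)
    simp only
    gcongr
    exact tailSum_mono R _ this

end WeakTransport

namespace WeakTransport

variable {p : ℝ} {d : ℕ} {X : Type*}

/-- Partially penalised value function. -/
noncomputable def partVal (Q : X × Pp p d → ℝ≥0∞) (ε : ℝ≥0∞) (R : ℕ → ℝ) (m : ℕ) (x : X) : ℝ≥0∞ :=
  ⨅ ρ, Q (x, ρ) + ε * tailSum R m ρ

/-- Fully penalised value function. -/
noncomputable def penVal (Q : X × Pp p d → ℝ≥0∞) (ε : ℝ≥0∞) (R : ℕ → ℝ) (x : X) : ℝ≥0∞ :=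
  ⨅ ρ, Q (x, ρ) + ε * tailSeries R ρ

lemma partVal_mono (Q : X × Pp p d → ℝ≥0∞) (ε : ℝ≥0∞) (R : ℕ → ℝ) (x : X) :
    Monotone fun m => partVal Q ε R m x := fun m n h => by
  refine iInf_mono fun ρ => ?_
  gcongr
  exact tailSum_mono R ρ h

lemma partVal_le_penVal (Q : X × Pp p d → ℝ≥0∞) (ε : ℝ≥0∞) (R : ℕ → ℝ) (m : ℕ) (x : X) :
    partVal Q ε R m x ≤ penVal Q ε R x := by
  refine iInf_mono fun ρ => ?_
  gcongr
  exact tailSum_le_tailSeries R m ρ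

variable [TopologicalSpace X]

/-- The largest lower semicontinuous minorant of a function. -/
noncomputable def lscHull (f : X → ℝ≥0∞) (x : X) : ℝ≥0∞ :=
  ⨆ (U : Set X) (_ : IsOpen U ∧ x ∈ U), ⨅ y ∈ U, f y

lemma lowerSemicontinuous_lscHull (f : X → ℝ≥0∞) : LowerSemicontinuous (lscHull f) := by
  intro x a ha
  obtain ⟨U, hU, h⟩ : ∃ (U : Set X) (_ : IsOpen U ∧ x ∈ U), a < ⨅ y ∈ U, f y := by
    simpa only [lscHull, lt_iSup_iff] using ha
  filter_upwards [hU.1.mem_nhds hU.2] with y hy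
  exact h.trans_le (le_iSup₂_of_le U ⟨hU.1, hy⟩ le_rfl)

lemma lscHull_le (f : X → ℝ≥0∞) (x : X) : lscHull f x ≤ f x :=
  iSup₂_le fun _ hU => iInf₂_le x hU.2

lemma lscHull_mono {f g : X → ℝ≥0∞} (h : ∀ x, f x ≤ g x) (x : X) : lscHull f x ≤ lscHull g x :=
  iSup₂_mono fun _ _ => iInf₂_mono fun y _ => h y

section Pen

variable {R : ℕ → ℝ} {Q : X × Pp p d → ℝ≥0∞} {ε : ℝ≥0∞}

lemma exists_eq_penVal (hp : 1 ≤ p) (hR : Monotone R) (hQ : LowerSemicontinuous Q) (hε : ε ≠ 0)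
    (hε' : ε ≠ ⊤) {x : X} (hx : penVal Q ε R x ≠ ⊤) :
    ∃ ρ, Q (x, ρ) + ε * tailSeries R ρ ≤ penVal Q ε R x := by
  have h : ∀ n : ℕ, ∃ ρ : Pp p d, Q (x, ρ) + ε * tailSeries R ρ < penVal Q ε R x + (n + 1 : ℝ≥0∞)⁻¹ :=
    fun n => iInf_lt_iff.1 (ENNReal.lt_add_right hx (by simp))
  choose ρs hρs using h
  have hle1 : ∀ n : ℕ, (n + 1 : ℝ≥0∞)⁻¹ ≤ 1 := fun n => ENNReal.inv_le_one.2 le_add_self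
  obtain ⟨ρ, φ, hφ, hlim, -⟩ := exists_subseq_of_le hp hR hQ hε hε'
    (xs := fun _ => x) (x := x) tendsto_const_nhds (c := penVal Q ε R x + 1) (ρs := ρs)
    (ENNReal.add_ne_top.2 ⟨hx, ENNReal.one_ne_top⟩) fun m => by
      refine le_trans ?_ ((hρs m).le.trans (add_le_add_right (hle1 m) _))
      gcongr
      exact tailSum_le_tailSeries R m _
  refine ⟨ρ, le_of_forall_gt_imp_ge_of_dense fun c hc => ?_⟩
  have hl : LowerSemicontinuous fun ρ : Pp p d => Q (x, ρ) + ε * tailSeries R ρ := by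
    refine (hQ.comp (by fun_prop : Continuous fun ρ : Pp p d => (x, ρ))).add ?_
    exact (ENNReal.continuous_const_mul hε').comp_lowerSemicontinuous
      (lowerSemicontinuous_tailSeries hp R) fun a b hab => mul_le_mul' le_rfl hab
  change ρ ∈ (fun ρ : Pp p d => Q (x, ρ) + ε * tailSeries R ρ) ⁻¹' Iic c
  refine (hl.isClosed_preimage c).mem_of_tendsto hlim ?_
  have h0 : Tendsto (fun n : ℕ => penVal Q ε R x + ((n : ℝ≥0∞) + 1)⁻¹) atTop (𝓝 (penVal Q ε R x + 0)) := by
    refine tendsto_const_nhds.add ?_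
    have := (tendsto_add_atTop_iff_nat 1).2 ENNReal.tendsto_inv_nat_nhds_zero
    simpa using this
  rw [add_zero] at h0
  filter_upwards [(h0.comp hφ.tendsto_atTop).eventually_lt_const hc] with n hn
  exact (hρs (φ n)).le.trans hn.le

variable [FirstCountableTopology X]

lemma penVal_eq_iSup (hp : 1 ≤ p) (hR : Monotone R) (hQ : LowerSemicontinuous Q) (hε : ε ≠ 0)
    (hε' : ε ≠ ⊤) (x : X) : penVal Q ε R x = ⨆ m, lscHull (partVal Q ε R m) x := by
  refine le_antisymm (le_of_forall_gt_imp_ge_of_dense fun c hc => ?_)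
    (iSup_le fun m => (lscHull_le _ x).trans (partVal_le_penVal Q ε R m x))
  rcases eq_or_ne c ⊤ with rfl | hc'
  · exact le_top
  obtain ⟨U, hU⟩ := (𝓝 x).exists_antitone_basis
  have h : ∀ m, ∃ (y : X) (ρ : Pp p d), y ∈ U m ∧ Q (y, ρ) + ε * tailSum R m ρ < c := fun m => by
    have h1 : lscHull (partVal Q ε R m) x < c :=
      (le_iSup (fun m => lscHull (partVal Q ε R m) x) m).trans_lt hc
    have h2 : ⨅ y ∈ interior (U m), partVal Q ε R m y < c :=
      (le_iSup₂_of_le (f := fun (U : Set X) (_ : IsOpen U ∧ x ∈ U) => ⨅ y ∈ U, partVal Q ε R m y)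
        (interior (U m)) ⟨isOpen_interior, mem_interior_iff_mem_nhds.2 (hU.1.mem_of_mem trivial)⟩
        le_rfl).trans_lt h1
    obtain ⟨y, hy, h3⟩ := by simpa only [iInf_lt_iff] using h2
    obtain ⟨ρ, h4⟩ := iInf_lt_iff.1 h3
    exact ⟨y, ρ, interior_subset hy, h4⟩
  choose y ρs hy hlt using h
  obtain ⟨ρ, -, -, -, hle⟩ := exists_subseq_of_le hp hR hQ hε hε' (hU.tendsto hy) hc'
    fun m => (hlt m).le
  exact (iInf_le _ ρ).trans hle

lemma lowerSemicontinuous_penVal (hp : 1 ≤ p) (hR : Monotone R) (hQ : LowerSemicontinuous Q)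
    (hε : ε ≠ 0) (hε' : ε ≠ ⊤) : LowerSemicontinuous (penVal Q ε R) := by
  rw [funext fun x => penVal_eq_iSup hp hR hQ hε hε' x]
  exact lowerSemicontinuous_iSup fun m => lowerSemicontinuous_lscHull _

end Pen

/-- Midpoint of two measures. -/
noncomputable def mid (ρ₁ ρ₂ : Pp p d) : Pp p d :=
  mix 2⁻¹ (ENNReal.inv_le_one.2 one_le_two) ρ₁ ρ₂

lemma integral_mid (hp : 1 ≤ p) (ρ₁ ρ₂ : Pp p d) {f : Rd d → ℝ} (hf : GrowthP p f) :
    ∫ y, f y ∂(mid ρ₁ ρ₂).1 = (∫ y, f y ∂ρ₁.1 + ∫ y, f y ∂ρ₂.1) / 2 := by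
  rw [mid, integral_mix _ _ _ hf hp]
  simp
  ring

lemma coord_mid (hp : 1 ≤ p) (k : ℕ) (ρ₁ ρ₂ : Pp p d) :
    coord k (mid ρ₁ ρ₂) = (coord k ρ₁ + coord k ρ₂) / 2 :=
  integral_mid hp _ _ (growthP_testFn k)

lemma tailSeries_mid (R : ℕ → ℝ) (ρ₁ ρ₂ : Pp p d) :
    tailSeries R (mid ρ₁ ρ₂) = 2⁻¹ * tailSeries R ρ₁ + 2⁻¹ * tailSeries R ρ₂ := by
  rw [mid, tailSeries_mix, ENNReal.one_sub_inv_two]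

/-- Weights making the series of squared coordinates summable. -/
noncomputable def weight (d k : ℕ) : ℝ := (1 / 2) ^ k / ((testBound d k : ℝ) ^ 2 + 1)

lemma weight_pos (k : ℕ) : 0 < weight d k := by unfold weight; positivity

/-- A bounded, strictly convex function on `P_p`. -/
noncomputable def theta (ρ : Pp p d) : ℝ≥0∞ := ∑' k, ENNReal.ofReal (weight d k * coord k ρ ^ 2)

/-- The modulus of strict convexity of `theta`. -/
noncomputable def gap (ρ₁ ρ₂ : Pp p d) : ℝ≥0∞ :=
  ∑' k, ENNReal.ofReal (weight d k / 4 * (coord k ρ₁ - coord k ρ₂) ^ 2)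

lemma theta_le (ρ : Pp p d) : theta ρ ≤ 2 := by
  have h : ∀ k, ENNReal.ofReal (weight d k * coord k ρ ^ 2) ≤ 2⁻¹ ^ k := fun k => by
    have : (2⁻¹ : ℝ≥0∞) ^ k = ENNReal.ofReal ((1 / 2) ^ k) := by
      rw [ENNReal.ofReal_pow (by norm_num), one_div, ENNReal.ofReal_inv_of_pos two_pos]
      simp
    rw [this]
    refine ENNReal.ofReal_le_ofReal ?_
    unfold weight
    rw [div_mul_eq_mul_div, div_le_iff₀ (by positivity)]
    have := pow_le_pow_left₀ (coord_nonneg k ρ) (coord_le k ρ) 2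
    gcongr
    linarith
  exact (ENNReal.tsum_le_tsum h).trans_eq (ENNReal.tsum_geometric_two)

lemma lowerSemicontinuous_theta : LowerSemicontinuous (theta : Pp p d → ℝ≥0∞) :=
  lowerSemicontinuous_tsum fun k => (ENNReal.continuous_ofReal.comp
    (continuous_const.mul ((continuous_coord k).pow 2))).lowerSemicontinuous

lemma theta_mid_add_gap (hp : 1 ≤ p) (ρ₁ ρ₂ : Pp p d) :
    theta (mid ρ₁ ρ₂) + gap ρ₁ ρ₂ = 2⁻¹ * theta ρ₁ + 2⁻¹ * theta ρ₂ := by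
  unfold theta gap
  rw [← ENNReal.tsum_add, ← ENNReal.tsum_mul_left, ← ENNReal.tsum_mul_left, ← ENNReal.tsum_add]
  refine tsum_congr fun k => ?_
  have h0 := (weight_pos (d := d) k).le
  have e : (2⁻¹ : ℝ≥0∞) = ENNReal.ofReal 2⁻¹ := by
    rw [ENNReal.ofReal_inv_of_pos two_pos]; simp
  rw [coord_mid hp, e, ← ENNReal.ofReal_mul (by norm_num), ← ENNReal.ofReal_mul (by norm_num),
    ← ENNReal.ofReal_add (by positivity) (by positivity),
    ← ENNReal.ofReal_add (by positivity) (by positivity)]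
  congr 1
  ring

lemma eq_of_gap_eq_zero (hp : 1 ≤ p) {ρ₁ ρ₂ : Pp p d} (h : gap ρ₁ ρ₂ = 0) : ρ₁ = ρ₂ := by
  refine eq_of_coord_eq hp fun k => ?_
  have h1 := ENNReal.ofReal_eq_zero.1 (ENNReal.tsum_eq_zero.1 h k)
  have h2 := weight_pos (d := d) k
  have h3 : (coord k ρ₁ - coord k ρ₂) ^ 2 ≤ 0 := by nlinarith
  have h4 := pow_eq_zero_iff (two_ne_zero) |>.1 (le_antisymm h3 (sq_nonneg _))
  linarith

section Selection

variable [FirstCountableTopology X] [MeasurableSpace X] [OpensMeasurableSpace X]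
  {R : ℕ → ℝ} {Q : X × Pp p d → ℝ≥0∞} {ε : ℝ≥0∞}

lemma exists_measurable_argmin (hp : 1 ≤ p) (hR : Monotone R) (hQ : LowerSemicontinuous Q)
    (hε : ε ≠ 0) (hε' : ε ≠ ⊤)
    (huniq : ∀ x ρ₁ ρ₂, penVal Q ε R x ≠ ⊤ → Q (x, ρ₁) + ε * tailSeries R ρ₁ ≤ penVal Q ε R x →
      Q (x, ρ₂) + ε * tailSeries R ρ₂ ≤ penVal Q ε R x → ρ₁ = ρ₂) :
    ∃ κ : X → Pp p d, Measurable κ ∧ ∀ x, penVal Q ε R x ≠ ⊤ →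
      Q (x, κ x) + ε * tailSeries R (κ x) ≤ penVal Q ε R x := by
  classical
  have hm : Measurable (penVal Q ε R) := (lowerSemicontinuous_penVal hp hR hQ hε hε').measurable
  have hex : ∀ x, ∃ ρ : Pp p d, (penVal Q ε R x ≠ ⊤ →
      Q (x, ρ) + ε * tailSeries R ρ ≤ penVal Q ε R x) ∧ (penVal Q ε R x = ⊤ → ρ = diracPp p 0) :=
    fun x => by
      by_cases hx : penVal Q ε R x = ⊤
      · exact ⟨diracPp p 0, fun h => absurd hx h, fun _ => rfl⟩
      · obtain ⟨ρ, h⟩ := exists_eq_penVal hp hR hQ hε hε' hx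
        exact ⟨ρ, fun _ => h, fun h => absurd h hx⟩
  choose κ hκ hκ' using hex
  refine ⟨κ, measurable_of_coord hp fun k => measurable_of_Iic fun a => ?_, hκ⟩
  let I : Pp p d → ℝ≥0∞ := ({ρ | a < coord k ρ} : Set (Pp p d)).indicator fun _ => ⊤
  have hI : LowerSemicontinuous I :=
    (isOpen_lt continuous_const (continuous_coord k)).lowerSemicontinuous_indicator zero_le
  let Q' : X × Pp p d → ℝ≥0∞ := fun q => Q q + I q.2
  have hQ' : LowerSemicontinuous Q' := hQ.add (hI.comp continuous_snd)
  have hm' : Measurable (penVal Q' ε R) := (lowerSemicontinuous_penVal hp hR hQ' hε hε').measurable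
  have hset : (fun x => coord k (κ x)) ⁻¹' Iic a =
      ({x | penVal Q ε R x = ⊤} ∩ {_x | coord k (diracPp p 0 : Pp p d) ≤ a}) ∪
        ({x | penVal Q ε R x ≠ ⊤} ∩ {x | penVal Q' ε R x ≤ penVal Q ε R x}) := by
    ext x
    simp only [mem_preimage, mem_Iic, mem_union, mem_inter_iff, mem_ofPred_eq]
    by_cases hx : penVal Q ε R x = ⊤
    · simp [hx, hκ' x hx]
    · simp only [hx, false_and, ne_eq, not_false_eq_true, true_and, false_or]
      constructor
      · intro h
        refine (iInf_le _ (κ x)).trans (le_trans ?_ (hκ x hx))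
        simp [Q', I, h]
      · intro h
        obtain ⟨ρ, hρ⟩ := exists_eq_penVal hp hR hQ' hε hε' (ne_top_of_le_ne_top hx h)
        have h1 := hρ.trans h
        have h2 : coord k ρ ≤ a := by
          by_contra hcon
          have : I ρ = ⊤ := by simp [I, not_le.1 hcon]
          simp [Q', this] at h1
          exact hx h1
        have h3 : Q (x, ρ) + ε * tailSeries R ρ ≤ penVal Q ε R x := by
          refine le_trans ?_ h1
          gcongr
          exact le_self_add
        rw [huniq x (κ x) ρ hx (hκ x hx) h3]
        exact h2
  rw [hset]
  refine ((hm (measurableSet_singleton ⊤)).inter (MeasurableSet.const _)).union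
    (((hm (measurableSet_singleton ⊤)).compl).inter (measurableSet_le hm' hm))

lemma exists_measurable_selection (hp : 1 ≤ p) (hR : Monotone R) (hQ : LowerSemicontinuous Q)
    (hQc : ∀ x ρ₁ ρ₂, Q (x, mid ρ₁ ρ₂) ≤ 2⁻¹ * Q (x, ρ₁) + 2⁻¹ * Q (x, ρ₂))
    (hε : ε ≠ 0) (hε' : ε ≠ ⊤) {μ : Measure X} [IsProbabilityMeasure μ]
    (hfin : ∫⁻ x, penVal Q ε R x ∂μ ≠ ⊤) {δ : ℝ≥0∞} (hδ : δ ≠ 0) (hδ' : δ ≠ ⊤) :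
    ∃ κ : X → Pp p d, Measurable κ ∧
      ∫⁻ x, (Q (x, κ x) + ε * tailSeries R (κ x)) ∂μ ≤ ∫⁻ x, penVal Q ε R x ∂μ + δ * 2 := by
  let Q' : X × Pp p d → ℝ≥0∞ := fun q => Q q + δ * theta q.2
  have hQ' : LowerSemicontinuous Q' :=
    hQ.add (((ENNReal.continuous_const_mul hδ').comp_lowerSemicontinuous
      lowerSemicontinuous_theta fun a b hab => by gcongr).comp continuous_snd)
  have hle : ∀ x, penVal Q' ε R x ≤ penVal Q ε R x + δ * 2 := fun x => by
    unfold penVal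
    rw [ENNReal.iInf_add]
    refine iInf_mono fun ρ => ?_
    simp only [Q']
    rw [add_right_comm]
    gcongr
    exact theta_le ρ
  obtain ⟨κ, hκ, h⟩ := exists_measurable_argmin hp hR hQ' hε hε' fun x ρ₁ ρ₂ hx h1 h2 => by
    have h3 : penVal Q' ε R x ≤ Q' (x, mid ρ₁ ρ₂) + ε * tailSeries R (mid ρ₁ ρ₂) := iInf_le _ _
    have h4 : Q' (x, mid ρ₁ ρ₂) + ε * tailSeries R (mid ρ₁ ρ₂) + δ * gap ρ₁ ρ₂
        ≤ penVal Q' ε R x := by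
      calc Q' (x, mid ρ₁ ρ₂) + ε * tailSeries R (mid ρ₁ ρ₂) + δ * gap ρ₁ ρ₂
          = Q (x, mid ρ₁ ρ₂) + δ * (theta (mid ρ₁ ρ₂) + gap ρ₁ ρ₂)
              + ε * tailSeries R (mid ρ₁ ρ₂) := by simp only [Q']; ring
        _ ≤ (2⁻¹ * Q (x, ρ₁) + 2⁻¹ * Q (x, ρ₂)) + δ * (2⁻¹ * theta ρ₁ + 2⁻¹ * theta ρ₂)
              + ε * (2⁻¹ * tailSeries R ρ₁ + 2⁻¹ * tailSeries R ρ₂) := by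
            rw [theta_mid_add_gap hp, tailSeries_mid]
            gcongr
            exact hQc x ρ₁ ρ₂
        _ = 2⁻¹ * (Q' (x, ρ₁) + ε * tailSeries R ρ₁)
              + 2⁻¹ * (Q' (x, ρ₂) + ε * tailSeries R ρ₂) := by simp only [Q']; ring
        _ ≤ 2⁻¹ * penVal Q' ε R x + 2⁻¹ * penVal Q' ε R x := by gcongr
        _ = penVal Q' ε R x := by
            rw [← add_mul, ENNReal.inv_two_add_inv_two, one_mul]
    have h5 : penVal Q' ε R x + δ * gap ρ₁ ρ₂ ≤ penVal Q' ε R x + 0 := by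
      rw [add_zero]; exact (add_le_add_left h3 _).trans h4
    have h6 : δ * gap ρ₁ ρ₂ = 0 := le_antisymm ((ENNReal.add_le_add_iff_left hx).1 h5) zero_le
    exact eq_of_gap_eq_zero hp ((mul_eq_zero.1 h6).resolve_left hδ)
  refine ⟨κ, hκ, ?_⟩
  have hm : Measurable (penVal Q ε R) := (lowerSemicontinuous_penVal hp hR hQ hε hε').measurable
  have hae := ae_lt_top hm hfin
  calc ∫⁻ x, (Q (x, κ x) + ε * tailSeries R (κ x)) ∂μ
      ≤ ∫⁻ x, (penVal Q ε R x + δ * 2) ∂μ := by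
        refine lintegral_mono_ae ?_
        filter_upwards [hae] with x hx
        refine le_trans ?_ ((h x (ne_top_of_le_ne_top ?_ (hle x))).trans (hle x))
        · simp only [Q']
          gcongr
          exact le_self_add
        · exact ENNReal.add_ne_top.2 ⟨hx.ne, ENNReal.mul_ne_top hδ' (by simp)⟩
    _ = ∫⁻ x, penVal Q ε R x ∂μ + δ * 2 := by
        rw [lintegral_add_right _ measurable_const]; simp

end Selection

end WeakTransport

namespace WeakTransport

variable {p : ℝ} {d : ℕ} {X : Type*} [MeasurableSpace X]

/-- Penalised transport cost of a family of measures. -/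
noncomputable def cost (μ : Measure X) (Q : X × Pp p d → ℝ≥0∞) (ε : ℝ≥0∞) (R : ℕ → ℝ)
    (κ : X → Pp p d) : ℝ≥0∞ := ∫⁻ x, (Q (x, κ x) + ε * tailSeries R (κ x)) ∂μ

/-- Coordinates of the averaged measure. -/
noncomputable def meanCoord (μ : Measure X) (κ : X → Pp p d) (k : ℕ) : ℝ := ∫ x, coord k (κ x) ∂μ

lemma integrable_coord {μ : Measure X} [IsFiniteMeasure μ] {κ : X → Pp p d} (hκ : Measurable κ)
    (k : ℕ) : Integrable (fun x => coord k (κ x)) μ :=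
  Integrable.of_bound ((continuous_coord k).measurable.comp hκ).aestronglyMeasurable
    (testBound d k) (Eventually.of_forall fun x => by
      rw [Real.norm_of_nonneg (coord_nonneg _ _)]; exact coord_le _ _)

lemma coord_mix (hp : 1 ≤ p) {t : ℝ≥0∞} (ht : t ≤ 1) (k : ℕ) (ρ₁ ρ₂ : Pp p d) :
    coord k (mix t ht ρ₁ ρ₂) = t.toReal * coord k ρ₁ + (1 - t.toReal) * coord k ρ₂ :=
  integral_mix ht _ _ (growthP_testFn k) hp

lemma measurable_mix (hp : 1 ≤ p) {t : ℝ≥0∞} (ht : t ≤ 1) {κ₁ κ₂ : X → Pp p d}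
    (h₁ : Measurable κ₁) (h₂ : Measurable κ₂) : Measurable fun x => mix t ht (κ₁ x) (κ₂ x) := by
  refine measurable_of_coord hp fun k => ?_
  simp_rw [coord_mix hp]
  exact (measurable_const.mul ((continuous_coord k).measurable.comp h₁)).add
    (measurable_const.mul ((continuous_coord k).measurable.comp h₂))

lemma meanCoord_mix (hp : 1 ≤ p) {μ : Measure X} [IsFiniteMeasure μ] {t : ℝ≥0∞} (ht : t ≤ 1)
    {κ₁ κ₂ : X → Pp p d} (h₁ : Measurable κ₁) (h₂ : Measurable κ₂) (k : ℕ) :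
    meanCoord μ (fun x => mix t ht (κ₁ x) (κ₂ x)) k =
      t.toReal * meanCoord μ κ₁ k + (1 - t.toReal) * meanCoord μ κ₂ k := by
  unfold meanCoord
  simp_rw [coord_mix hp]
  rw [integral_add ((integrable_coord h₁ k).const_mul _) ((integrable_coord h₂ k).const_mul _),
    integral_const_mul, integral_const_mul]

section Top

variable [TopologicalSpace X] [OpensMeasurableSpace X]

lemma measurable_comp_graph (hp : 1 ≤ p) {Q : X × Pp p d → ℝ≥0∞} (hQ : LowerSemicontinuous Q)
    {κ : X → Pp p d} (hκ : Measurable κ) : Measurable fun x => Q (x, κ x) := by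
  have := secondCountable_Pp (d := d) hp
  exact hQ.measurable.comp (measurable_id.prodMk hκ)

lemma measurable_tailSeries_comp {Y : Type*} [MeasurableSpace Y] (hp : 1 ≤ p) (R : ℕ → ℝ)
    {κ : Y → Pp p d} (hκ : Measurable κ) : Measurable fun x => tailSeries R (κ x) :=
  (lowerSemicontinuous_tailSeries hp R).measurable.comp hκ

lemma measurable_cost_integrand (hp : 1 ≤ p) {Q : X × Pp p d → ℝ≥0∞} (hQ : LowerSemicontinuous Q)
    (ε : ℝ≥0∞) (R : ℕ → ℝ) {κ : X → Pp p d} (hκ : Measurable κ) :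
    Measurable fun x => Q (x, κ x) + ε * tailSeries R (κ x) :=
  (measurable_comp_graph hp hQ hκ).add ((measurable_tailSeries_comp hp R hκ).const_mul ε)

lemma cost_mix_le (hp : 1 ≤ p) {Q : X × Pp p d → ℝ≥0∞} (hQ : LowerSemicontinuous Q)
    (hQc : ∀ x ρ₁ ρ₂ (t : ℝ≥0∞) (ht : t ≤ 1),
      Q (x, mix t ht ρ₁ ρ₂) ≤ t * Q (x, ρ₁) + (1 - t) * Q (x, ρ₂))
    (μ : Measure X) (ε : ℝ≥0∞) (R : ℕ → ℝ) {t : ℝ≥0∞} (ht : t ≤ 1)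
    {κ₁ κ₂ : X → Pp p d} (h₁ : Measurable κ₁) (h₂ : Measurable κ₂) :
    cost μ Q ε R (fun x => mix t ht (κ₁ x) (κ₂ x))
      ≤ t * cost μ Q ε R κ₁ + (1 - t) * cost μ Q ε R κ₂ := by
  unfold cost
  have m₁ := measurable_cost_integrand hp hQ ε R h₁
  have m₂ := measurable_cost_integrand hp hQ ε R h₂
  rw [← lintegral_const_mul _ m₁, ← lintegral_const_mul _ m₂, ← lintegral_add_left (m₁.const_mul t)]
  refine lintegral_mono fun x => ?_
  simp only
  rw [tailSeries_mix]
  refine (add_le_add_left (hQc x _ _ t ht) _).trans_eq ?_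
  ring

end Top

/-- Families whose penalised cost is at most `s` and whose average is close to `ν` in the first
`n` coordinates. -/
def approxSet (μ : Measure X) (Q : X × Pp p d → ℝ≥0∞) (ε : ℝ≥0∞) (R : ℕ → ℝ) (ν : Pp p d)
    (s : ℝ≥0∞) (n : ℕ) : Set (X → Pp p d) :=
  {κ | Measurable κ ∧ cost μ Q ε R κ ≤ s ∧
    ∀ k < n, |meanCoord μ κ k - coord k ν| ≤ 1 / ((n : ℝ) + 1)}

lemma approxSet_anti (μ : Measure X) (Q : X × Pp p d → ℝ≥0∞) (ε : ℝ≥0∞) (R : ℕ → ℝ) (ν : Pp p d)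
    (s : ℝ≥0∞) {m n : ℕ} (h : m ≤ n) :
    approxSet μ Q ε R ν s n ⊆ approxSet μ Q ε R ν s m := by
  rintro κ ⟨h1, h2, h3⟩
  refine ⟨h1, h2, fun k hk => (h3 k (hk.trans_le h)).trans ?_⟩
  have : (m : ℝ) ≤ n := by exact_mod_cast h
  gcongr

lemma mid_mem_approxSet [TopologicalSpace X] [OpensMeasurableSpace X]
    (hp : 1 ≤ p) {Q : X × Pp p d → ℝ≥0∞} (hQ : LowerSemicontinuous Q)
    (hQc : ∀ x ρ₁ ρ₂ (t : ℝ≥0∞) (ht : t ≤ 1),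
      Q (x, mix t ht ρ₁ ρ₂) ≤ t * Q (x, ρ₁) + (1 - t) * Q (x, ρ₂))
    {μ : Measure X} [IsFiniteMeasure μ] {ε : ℝ≥0∞} {R : ℕ → ℝ} {ν : Pp p d} {s : ℝ≥0∞} {n : ℕ}
    {κ₁ κ₂ : X → Pp p d} (h₁ : κ₁ ∈ approxSet μ Q ε R ν s n) (h₂ : κ₂ ∈ approxSet μ Q ε R ν s n) :
    (fun x => mid (κ₁ x) (κ₂ x)) ∈ approxSet μ Q ε R ν s n := by
  have ht : (2⁻¹ : ℝ≥0∞) ≤ 1 := ENNReal.inv_le_one.2 one_le_two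
  refine ⟨measurable_mix hp ht h₁.1 h₂.1,
    (cost_mix_le hp hQ hQc μ ε R ht h₁.1 h₂.1).trans ?_, fun k hk => ?_⟩
  · rw [ENNReal.one_sub_inv_two]
    calc 2⁻¹ * cost μ Q ε R κ₁ + 2⁻¹ * cost μ Q ε R κ₂ ≤ 2⁻¹ * s + 2⁻¹ * s := by
          gcongr
          · exact h₁.2.1
          · exact h₂.2.1
      _ = s := by rw [← add_mul, ENNReal.inv_two_add_inv_two, one_mul]
  · have h3 := abs_le.1 (h₁.2.2 k hk)
    have h4 := abs_le.1 (h₂.2.2 k hk)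
    have := meanCoord_mix hp (μ := μ) ht h₁.1 h₂.1 k
    change |meanCoord μ (fun x => mix 2⁻¹ ht (κ₁ x) (κ₂ x)) k - _| ≤ _
    rw [this]
    simp only [ENNReal.toReal_inv, ENNReal.toReal_ofNat]
    exact abs_le.2 ⟨by linarith, by linarith⟩

lemma measurable_gap_comp {κ₁ κ₂ : X → Pp p d} (h₁ : Measurable κ₁) (h₂ : Measurable κ₂) :
    Measurable fun x => gap (κ₁ x) (κ₂ x) :=
  Measurable.tsum fun k => (measurable_const.mul ((((continuous_coord k).measurable.comp h₁).sub
    ((continuous_coord k).measurable.comp h₂)).pow_const 2)).ennreal_ofReal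

lemma measurable_theta_comp {κ : X → Pp p d} (h : Measurable κ) :
    Measurable fun x => theta (κ x) :=
  lowerSemicontinuous_theta.measurable.comp h

/-- A sequence in a decreasing family of midpoint convex sets whose consecutive gaps decay
geometrically. -/
lemma exists_seq_gap_le (hp : 1 ≤ p) {μ : Measure X} [IsProbabilityMeasure μ]
    {K : ℕ → Set (X → Pp p d)} (hanti : Antitone K) (hmeas : ∀ n, ∀ κ ∈ K n, Measurable κ)
    (hmid : ∀ n, ∀ κ₁ ∈ K n, ∀ κ₂ ∈ K n, (fun x => mid (κ₁ x) (κ₂ x)) ∈ K n)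
    (hne : ∀ n, (K n).Nonempty) :
    ∃ κ : ℕ → X → Pp p d, (∀ j, κ j ∈ K j) ∧
      ∀ j, ∫⁻ x, gap (κ j x) (κ (j + 1) x) ∂μ ≤ 2 * (8⁻¹ : ℝ≥0∞) ^ j := by
  let J : (X → Pp p d) → ℝ≥0∞ := fun κ => ∫⁻ x, theta (κ x) ∂μ
  let I : ℕ → ℝ≥0∞ := fun n => ⨅ κ ∈ K n, J κ
  have hJ : ∀ κ, J κ ≤ 2 := fun κ =>
    (lintegral_mono fun x => theta_le (κ x)).trans_eq (by simp)
  have hI : Monotone I := fun m n h => biInf_mono (hanti h)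
  have hI2 : ∀ n, I n ≤ 2 := fun n => by
    obtain ⟨κ, hκ⟩ := hne n
    exact (iInf₂_le κ hκ).trans (hJ κ)
  have hS : (⨆ n, I n) ≠ ⊤ := ne_top_of_le_ne_top (by simp) (iSup_le hI2)
  have hpos : ∀ j : ℕ, (8⁻¹ : ℝ≥0∞) ^ j ≠ 0 := fun j => by simp
  have hN : ∀ j : ℕ, ∃ N, (⨆ n, I n) ≤ I N + (8⁻¹ : ℝ≥0∞) ^ j := fun j => by
    by_cases h0 : (⨆ n, I n) = 0
    · exact ⟨0, h0.trans_le zero_le⟩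
    · obtain ⟨N, hN⟩ := lt_iSup_iff.1 (ENNReal.sub_lt_self hS h0 (hpos j))
      exact ⟨N, tsub_le_iff_right.1 hN.le⟩
  choose N hN using hN
  let n : ℕ → ℕ := fun j => ∑ i ∈ Finset.range (j + 1), (N i + 1)
  have hn1 : ∀ j, N j ≤ n j := fun j => (Nat.le_succ _).trans
    (Finset.single_le_sum (f := fun i => N i + 1) (fun _ _ => Nat.zero_le _)
      (Finset.mem_range.2 (Nat.lt_succ_self j)))
  have hn2 : ∀ j, j ≤ n j := fun j => by
    have : ∑ i ∈ Finset.range (j + 1), 1 ≤ n j := Finset.sum_le_sum fun i _ => by lia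
    simp at this
    lia
  have hn3 : Monotone n := fun i j h => by
    have : i + 1 ≤ j + 1 := by lia
    exact Finset.sum_le_sum_of_subset (Finset.range_mono this)
  have hex : ∀ j, ∃ κ ∈ K (n j), J κ < I (n j) + (8⁻¹ : ℝ≥0∞) ^ j := fun j => by
    have : I (n j) < I (n j) + (8⁻¹ : ℝ≥0∞) ^ j :=
      ENNReal.lt_add_right (ne_top_of_le_ne_top (by simp) (hI2 _)) (hpos j)
    simpa only [I, iInf_lt_iff, exists_prop] using this
  choose κ hκ hlt using hex
  refine ⟨κ, fun j => hanti (hn2 j) (hκ j), fun j => ?_⟩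
  have hκ' : κ (j + 1) ∈ K (n j) := hanti (hn3 (Nat.le_succ j)) (hκ (j + 1))
  have h1 : I (n j) ≤ J fun x => mid (κ j x) (κ (j + 1) x) := iInf₂_le _ (hmid _ _ (hκ j) _ hκ')
  have h2 : J (κ (j + 1)) ≤ I (n j) + 2 * (8⁻¹ : ℝ≥0∞) ^ j := by
    calc J (κ (j + 1)) ≤ (⨆ n, I n) + (8⁻¹ : ℝ≥0∞) ^ (j + 1) :=
          (hlt (j + 1)).le.trans (add_le_add_left (le_iSup I _) _)
      _ ≤ (I (n j) + (8⁻¹ : ℝ≥0∞) ^ j) + (8⁻¹ : ℝ≥0∞) ^ j := by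
          refine add_le_add ((hN j).trans (add_le_add_left (hI (hn1 j)) _)) ?_
          exact pow_le_pow_right_of_le_one' (ENNReal.inv_le_one.2 (by norm_num)) (Nat.le_succ j)
      _ = I (n j) + 2 * (8⁻¹ : ℝ≥0∞) ^ j := by ring
  have m1 := hmeas _ _ (hκ j)
  have m2 := hmeas _ _ hκ'
  have h3 : J (fun x => mid (κ j x) (κ (j + 1) x)) + ∫⁻ x, gap (κ j x) (κ (j + 1) x) ∂μ
      = 2⁻¹ * J (κ j) + 2⁻¹ * J (κ (j + 1)) := by
    simp only [J]
    rw [← lintegral_add_right _ (measurable_gap_comp m1 m2),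
      ← lintegral_const_mul _ (measurable_theta_comp m1),
      ← lintegral_const_mul _ (measurable_theta_comp m2),
      ← lintegral_add_left ((measurable_theta_comp m1).const_mul _)]
    exact lintegral_congr fun x => theta_mid_add_gap hp _ _
  have h4 : I (n j) + ∫⁻ x, gap (κ j x) (κ (j + 1) x) ∂μ ≤ I (n j) + 2 * (8⁻¹ : ℝ≥0∞) ^ j := by
    calc I (n j) + ∫⁻ x, gap (κ j x) (κ (j + 1) x) ∂μ
        ≤ 2⁻¹ * J (κ j) + 2⁻¹ * J (κ (j + 1)) := (add_le_add_left h1 _).trans_eq h3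
      _ ≤ 2⁻¹ * (I (n j) + 2 * (8⁻¹ : ℝ≥0∞) ^ j) + 2⁻¹ * (I (n j) + 2 * (8⁻¹ : ℝ≥0∞) ^ j) := by
          gcongr
          refine (hlt j).le.trans ?_
          gcongr
          exact le_mul_of_one_le_left zero_le one_le_two
      _ = I (n j) + 2 * (8⁻¹ : ℝ≥0∞) ^ j := by
          rw [← add_mul, ENNReal.inv_two_add_inv_two, one_mul]
  exact (ENNReal.add_le_add_iff_left (ne_top_of_le_ne_top (by simp) (hI2 _))).1 h4

lemma cauchySeq_coord_of_gap {ρs : ℕ → Pp p d}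
    (h : ∑' j, (4 : ℝ≥0∞) ^ j * gap (ρs j) (ρs (j + 1)) ≠ ⊤) (k : ℕ) :
    CauchySeq fun j => coord k (ρs j) := by
  set S := (∑' j, (4 : ℝ≥0∞) ^ j * gap (ρs j) (ρs (j + 1))).toReal with hS
  have hw := weight_pos (d := d) k
  have hS0 : 0 ≤ S := ENNReal.toReal_nonneg
  refine cauchySeq_of_le_geometric (1 / 2) (Real.sqrt (4 * S / weight d k)) (by norm_num) fun j => ?_
  have h1 : ENNReal.ofReal (4 ^ j * (weight d k / 4 * (coord k (ρs j) - coord k (ρs (j + 1))) ^ 2))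
      ≤ ∑' j, (4 : ℝ≥0∞) ^ j * gap (ρs j) (ρs (j + 1)) := by
    refine le_trans ?_ (ENNReal.le_tsum j)
    rw [ENNReal.ofReal_mul (by positivity), ENNReal.ofReal_pow (by norm_num)]
    simp only [ENNReal.ofReal_ofNat]
    gcongr
    exact ENNReal.le_tsum k
  have h2 := (ENNReal.ofReal_le_iff_le_toReal h).1 h1
  rw [← hS] at h2
  rw [Real.dist_eq]
  refine abs_le_of_sq_le_sq ?_ (by positivity)
  rw [mul_pow, Real.sq_sqrt (by positivity), div_mul_eq_mul_div, le_div_iff₀ hw, ← pow_mul,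
    mul_comm j 2, pow_mul]
  have h3 : ((1 / 2 : ℝ) ^ 2) ^ j * 4 ^ j = 1 := by rw [← mul_pow]; norm_num
  have h4 : (0 : ℝ) < ((1 / 2 : ℝ) ^ 2) ^ j := by positivity
  have h5 := mul_le_mul_of_nonneg_left h2 h4.le
  rw [← mul_assoc, h3] at h5
  linarith

end WeakTransport

namespace WeakTransport

variable {p : ℝ} {d : ℕ} {X : Type*}

lemma exists_limit_of_liminf [TopologicalSpace X] (hp : 1 ≤ p) {R : ℕ → ℝ} (hR : Monotone R) {Q : X × Pp p d → ℝ≥0∞}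
    (hQ : LowerSemicontinuous Q) {ε : ℝ≥0∞} (hε : ε ≠ 0) (hε' : ε ≠ ⊤) {x : X} {ρs : ℕ → Pp p d}
    (hcoord : ∀ k, ∃ c, Tendsto (fun j => coord k (ρs j)) atTop (𝓝 c))
    (hfin : liminf (fun j => Q (x, ρs j) + ε * tailSeries R (ρs j)) atTop ≠ ⊤) :
    ∃ ρ : Pp p d, (∀ k, Tendsto (fun j => coord k (ρs j)) atTop (𝓝 (coord k ρ))) ∧
      Q (x, ρ) + ε * tailSeries R ρ
        ≤ liminf (fun j => Q (x, ρs j) + ε * tailSeries R (ρs j)) atTop := by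
  set l := liminf (fun j => Q (x, ρs j) + ε * tailSeries R (ρs j)) atTop with hl
  choose c hc using hcoord
  have key : ∀ b : ℝ≥0∞, l < b → b ≠ ⊤ → ∃ ρ : Pp p d,
      (∀ k, coord k ρ = c k) ∧ Q (x, ρ) + ε * tailSeries R ρ ≤ b := fun b hb hb' => by
    have hfreq : ∃ᶠ j in atTop, Q (x, ρs j) + ε * tailSeries R (ρs j) < b :=
      frequently_lt_of_liminf_lt (by isBoundedDefault) hb
    obtain ⟨φ, hφ, hlt⟩ := extraction_of_frequently_atTop hfreq
    obtain ⟨ρ, χ, hχ, hlim, hle⟩ := exists_subseq_of_le hp hR hQ hε hε' (xs := fun _ => x)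
      tendsto_const_nhds (ρs := ρs ∘ φ) hb' fun m => by
        refine le_trans ?_ (hlt m).le
        simp only [Function.comp_apply]
        gcongr
        exact tailSum_le_tailSeries R m _
    refine ⟨ρ, fun k => ?_, hle⟩
    exact tendsto_nhds_unique (((continuous_coord k).tendsto ρ).comp hlim)
      ((hc k).comp (hφ.comp hχ).tendsto_atTop)
  obtain ⟨ρ, hρ, -⟩ := key (l + 1) (ENNReal.lt_add_right hfin one_ne_zero)
    (ENNReal.add_ne_top.2 ⟨hfin, ENNReal.one_ne_top⟩)
  refine ⟨ρ, fun k => (hρ k).symm ▸ hc k, le_of_forall_gt_imp_ge_of_dense fun b hb => ?_⟩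
  rcases eq_or_ne b ⊤ with rfl | hb'
  · exact le_top
  obtain ⟨ρ', hρ', hle⟩ := key b hb hb'
  rwa [eq_of_coord_eq hp fun k => (hρ k).trans (hρ' k).symm]

variable [MeasurableSpace X]

/-- The Markov kernel given by a measurable family. -/
noncomputable def toKernel (hp : 1 ≤ p) {κ : X → Pp p d} (hκ : Measurable κ) :
    ProbabilityTheory.Kernel X (Rd d) := ⟨fun x => (κ x).1, (measurable_coe_measure hp).comp hκ⟩

instance (hp : 1 ≤ p) {κ : X → Pp p d} (hκ : Measurable κ) :
    ProbabilityTheory.IsMarkovKernel (toKernel hp hκ) :=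
  ⟨fun x => isProbabilityMeasure_coe (κ x)⟩

lemma primal_le_of_kernel (hp : 1 ≤ p) {μ : Measure X} [IsProbabilityMeasure μ]
    {ν : Measure (Rd d)} [IsProbabilityMeasure ν] (C : X → Measure (Rd d) → ℝ≥0∞) {κ : X → Pp p d}
    (hκ : Measurable κ)
    (h : ∀ k, meanCoord μ κ k = ∫ y, (testFn d k y : ℝ) ∂ν) :
    primal μ ν C ≤ ∫⁻ x, C x (κ x).1 ∂μ := by
  let π : Measure (X × Rd d) := μ.compProd (toKernel hp hκ)
  have hfst : π.map Prod.fst = μ := Measure.fst_compProd μ (toKernel hp hκ)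
  have hsnd : π.map Prod.snd = ν := by
    have e : π.map Prod.snd = μ.bind (toKernel hp hκ) := Measure.snd_compProd μ (toKernel hp hκ)
    have : IsProbabilityMeasure (π.map Prod.snd) :=
      Measure.isProbabilityMeasure_map measurable_snd.aemeasurable
    refine measure_eq_of_testFn fun k => ?_
    rw [e, Measure.lintegral_bind (toKernel hp hκ).measurable.aemeasurable
      (continuous_testFn k).measurable.coe_nnreal_ennreal.aemeasurable]
    have e1 : ∀ x, ∫⁻ y, (testFn d k y : ℝ≥0∞) ∂(toKernel hp hκ x) = ENNReal.ofReal (coord k (κ x)) :=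
      fun x => lintegral_testFn hp k (κ x)
    simp_rw [e1]
    rw [← ofReal_integral_eq_lintegral_ofReal (integrable_coord hκ k)
      (Eventually.of_forall fun x => coord_nonneg _ _)]
    change ENNReal.ofReal (meanCoord μ κ k) = _
    rw [h k, ofReal_integral_eq_lintegral_ofReal]
    · simp
    · exact Integrable.of_bound
        (NNReal.continuous_coe.comp (continuous_testFn _)).aestronglyMeasurable
        (testBound d k) (Eventually.of_forall fun y => by simpa using testFn_le k y)
    · exact Eventually.of_forall fun y => NNReal.coe_nonneg _
  have hπ : IsProbabilityMeasure π := inferInstanceAs (IsProbabilityMeasure (μ.compProd _))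
  refine (iInf_le _ ⟨π, hπ, hfst, hsnd⟩).trans_eq (lintegral_congr_ae ?_)
  have hd : disint π = π.condKernel := by
    unfold disint
    rw [dif_pos (inferInstance : IsFiniteMeasure π)]
  have hcond : ∀ᵐ x ∂π.fst, toKernel hp hκ x = π.condKernel x :=
    ProbabilityTheory.eq_condKernel_of_measure_eq_compProd (toKernel hp hκ) (by
      rw [show π.fst = μ from hfst])
  rw [show π.fst = μ from hfst] at hcond
  filter_upwards [hcond] with x hx
  simp only
  rw [hd, ← hx]
  rfl

variable [TopologicalSpace X] [OpensMeasurableSpace X]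

lemma exists_of_approxSet_nonempty (hp : 1 ≤ p) {R : ℕ → ℝ} (hR : Monotone R)
    {Q : X × Pp p d → ℝ≥0∞} (hQ : LowerSemicontinuous Q)
    (hQc : ∀ x ρ₁ ρ₂ (t : ℝ≥0∞) (ht : t ≤ 1),
      Q (x, mix t ht ρ₁ ρ₂) ≤ t * Q (x, ρ₁) + (1 - t) * Q (x, ρ₂))
    {ε : ℝ≥0∞} (hε : ε ≠ 0) (hε' : ε ≠ ⊤) {μ : Measure X} [IsProbabilityMeasure μ] {ν : Pp p d}
    {s : ℝ≥0∞} (hs : s ≠ ⊤) (hne : ∀ n, (approxSet μ Q ε R ν s n).Nonempty) :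
    ∃ κ : X → Pp p d, Measurable κ ∧ cost μ Q ε R κ ≤ s ∧ ∀ k, meanCoord μ κ k = coord k ν := by
  classical
  obtain ⟨κ, hκ, hgap⟩ := exists_seq_gap_le hp (μ := μ) (K := approxSet μ Q ε R ν s)
    (fun m n h => approxSet_anti μ Q ε R ν s h) (fun n κ h => h.1)
    (fun n κ₁ h₁ κ₂ h₂ => mid_mem_approxSet hp hQ hQc h₁ h₂) hne
  have hm : ∀ j, Measurable (κ j) := fun j => (hκ j).1
  have hmeas := fun j => measurable_cost_integrand hp hQ ε R (hm j)
  have hfatou : ∫⁻ x, liminf (fun j => Q (x, κ j x) + ε * tailSeries R (κ j x)) atTop ∂μ ≤ s := by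
    refine (lintegral_liminf_le hmeas).trans ?_
    refine liminf_le_of_frequently_le' (Eventually.of_forall fun j => (hκ j).2.1).frequently
  have hsum : ∫⁻ x, ∑' j, (4 : ℝ≥0∞) ^ j * gap (κ j x) (κ (j + 1) x) ∂μ ≠ ⊤ := by
    rw [lintegral_tsum fun j => ((measurable_gap_comp (hm j) (hm (j + 1))).const_mul _).aemeasurable]
    have hle : ∀ j, ∫⁻ x, (4 : ℝ≥0∞) ^ j * gap (κ j x) (κ (j + 1) x) ∂μ ≤ 2 * (2⁻¹ : ℝ≥0∞) ^ j :=
      fun j => by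
        rw [lintegral_const_mul _ (measurable_gap_comp (hm j) (hm (j + 1)))]
        calc (4 : ℝ≥0∞) ^ j * ∫⁻ x, gap (κ j x) (κ (j + 1) x) ∂μ
            ≤ 4 ^ j * (2 * (8⁻¹ : ℝ≥0∞) ^ j) := by gcongr; exact hgap j
          _ = 2 * (4 * 8⁻¹) ^ j := by rw [mul_pow]; ring
          _ = 2 * (2⁻¹ : ℝ≥0∞) ^ j := by
              congr 2
              rw [show (8 : ℝ≥0∞) = 4 * 2 by norm_num, ENNReal.mul_inv (by simp) (by simp),
                ← mul_assoc, ENNReal.mul_inv_cancel (by simp) (by simp), one_mul]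
    refine ne_top_of_le_ne_top ?_ (ENNReal.tsum_le_tsum hle)
    rw [ENNReal.tsum_mul_left, ENNReal.tsum_geometric_two]
    exact ENNReal.mul_ne_top (by simp) (by simp)
  have hae : ∀ᵐ x ∂μ, ∃ ρ : Pp p d, (∀ k, Tendsto (fun j => coord k (κ j x)) atTop (𝓝 (coord k ρ))) ∧
      Q (x, ρ) + ε * tailSeries R ρ
        ≤ liminf (fun j => Q (x, κ j x) + ε * tailSeries R (κ j x)) atTop := by
    have h1 := ae_lt_top (Measurable.liminf hmeas) (ne_top_of_le_ne_top hs hfatou)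
    have h2 := ae_lt_top (Measurable.tsum fun j =>
      ((measurable_gap_comp (hm j) (hm (j + 1))).const_mul _)) hsum
    filter_upwards [h1, h2] with x hx1 hx2
    exact exists_limit_of_liminf hp hR hQ hε hε'
      (fun k => cauchySeq_tendsto_of_complete (cauchySeq_coord_of_gap hx2.ne k)) hx1.ne
  obtain ⟨N, hN, hNm, hN0⟩ := exists_measurable_superset_of_null (ae_iff.1 hae)
  have hgood : ∀ x, ∃ ρ : Pp p d, x ∉ N →
      (∀ k, Tendsto (fun j => coord k (κ j x)) atTop (𝓝 (coord k ρ))) ∧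
      Q (x, ρ) + ε * tailSeries R ρ
        ≤ liminf (fun j => Q (x, κ j x) + ε * tailSeries R (κ j x)) atTop := fun x => by
    by_cases hx : x ∈ N
    · exact ⟨diracPp p 0, fun h => absurd hx h⟩
    · have : ¬ x ∈ {x | ¬ _} := fun h => hx (hN h)
      obtain ⟨ρ, hρ⟩ := not_not.1 this
      exact ⟨ρ, fun _ => hρ⟩
  choose κ₀ hκ₀ using hgood
  let κ' : X → Pp p d := N.piecewise (fun _ => diracPp p 0) κ₀
  have hNae : ∀ᵐ x ∂μ, x ∉ N := measure_eq_zero_iff_ae_notMem.1 hN0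
  have hκ'N : ∀ x ∉ N, κ' x = κ₀ x := fun x hx => piecewise_eq_of_notMem _ _ _ hx
  refine ⟨κ', measurable_of_coord hp fun k => ?_, ?_, fun k => ?_⟩
  · refine measurable_of_tendsto_metrizable (f := fun j =>
      N.piecewise (fun _ => coord k (diracPp p 0 : Pp p d)) fun x => coord k (κ j x))
      (fun j => Measurable.piecewise hNm measurable_const
        ((continuous_coord k).measurable.comp (hm j))) ?_
    refine tendsto_pi_nhds.2 fun x => ?_
    by_cases hx : x ∈ N
    · simp [κ', hx]
    · simpa [κ', hx] using (hκ₀ x hx).1 k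
  · refine le_trans (lintegral_mono_ae ?_) hfatou
    filter_upwards [hNae] with x hx
    rw [hκ'N x hx]
    exact (hκ₀ x hx).2
  · have h1 : Tendsto (fun j => meanCoord μ (κ j) k) atTop (𝓝 (meanCoord μ κ' k)) := by
      refine tendsto_integral_of_dominated_convergence (fun _ => (testBound d k : ℝ))
        (fun j => (integrable_coord (hm j) k).1) (integrable_const _) (fun j => ?_) ?_
      · exact Eventually.of_forall fun x => by
          rw [Real.norm_of_nonneg (coord_nonneg _ _)]; exact coord_le _ _
      · filter_upwards [hNae] with x hx
        rw [hκ'N x hx]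
        exact (hκ₀ x hx).1 k
    have h2 : Tendsto (fun j => meanCoord μ (κ j) k) atTop (𝓝 (coord k ν)) := by
      rw [tendsto_iff_dist_tendsto_zero]
      refine squeeze_zero' (Eventually.of_forall fun _ => dist_nonneg) ?_
        tendsto_one_div_add_atTop_nhds_zero_nat
      filter_upwards [eventually_gt_atTop k] with j hj
      exact (hκ j).2.2 k hj
    exact tendsto_nhds_unique h1 h2

end WeakTransport

namespace WeakTransport

variable {p : ℝ} {d : ℕ} {X : Type*} [MeasurableSpace X] [TopologicalSpace X]
  [OpensMeasurableSpace X]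

lemma clm_prod_apply {n : ℕ} (f : ((Fin n → ℝ) × ℝ) →L[ℝ] ℝ) (v : Fin n → ℝ) (t : ℝ) :
    f (v, t) = ∑ k, f (Pi.single k 1, 0) * v k + f (0, 1) * t := by
  have h1 : ((v, t) : (Fin n → ℝ) × ℝ) = ∑ k, v k • ((Pi.single k 1, 0) : (Fin n → ℝ) × ℝ)
      + t • ((0, 1) : (Fin n → ℝ) × ℝ) := by
    ext i
    · simp [Prod.fst_sum, Finset.sum_apply, Pi.single_apply]
    · simp [Prod.snd_sum]
  conv_lhs => rw [h1]
  rw [map_add, map_sum, map_smul]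
  simp only [map_smul, smul_eq_mul]
  congr 1
  · exact Finset.sum_congr rfl fun k _ => mul_comm _ _
  · exact mul_comm _ _

lemma exists_coeff_of_approxSet_empty (hp : 1 ≤ p) {R : ℕ → ℝ} {Q : X × Pp p d → ℝ≥0∞}
    (hQ : LowerSemicontinuous Q)
    (hQc : ∀ x ρ₁ ρ₂ (t : ℝ≥0∞) (ht : t ≤ 1),
      Q (x, mix t ht ρ₁ ρ₂) ≤ t * Q (x, ρ₁) + (1 - t) * Q (x, ρ₂))
    {ε : ℝ≥0∞} {μ : Measure X} [IsFiniteMeasure μ] {ν : Pp p d} {s : ℝ} (hs : 0 ≤ s) {n : ℕ}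
    (hempty : approxSet μ Q ε R ν (ENNReal.ofReal s) n = ∅) :
    ∃ c : Fin n → ℝ, ∀ κ : X → Pp p d, Measurable κ → ∀ t : ℝ, 0 ≤ t →
      cost μ Q ε R κ ≤ ENNReal.ofReal t → s ≤ t + ∑ k, c k * (meanCoord μ κ k - coord k ν) := by
  let v : (X → Pp p d) → Fin n → ℝ := fun κ k => meanCoord μ κ k - coord k ν
  let E : Set ((Fin n → ℝ) × ℝ) := {q | ∃ κ : X → Pp p d, Measurable κ ∧ 0 ≤ q.2 ∧
    cost μ Q ε R κ ≤ ENNReal.ofReal q.2 ∧ q.1 = v κ}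
  let B : Set ((Fin n → ℝ) × ℝ) := Metric.ball 0 (1 / ((n : ℝ) + 1)) ×ˢ Iio s
  have hn : (0 : ℝ) < 1 / ((n : ℝ) + 1) := by positivity
  have hE : Convex ℝ E := by
    rintro ⟨v₁, t₁⟩ ⟨κ₁, h₁, ht₁, hc₁, rfl⟩ ⟨v₂, t₂⟩ ⟨κ₂, h₂, ht₂, hc₂, rfl⟩ a b ha hb hab
    simp only at ht₁ ht₂ hc₁ hc₂
    have ha1 : ENNReal.ofReal a ≤ 1 := by rw [← ENNReal.ofReal_one]; exact ENNReal.ofReal_le_ofReal (by linarith)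
    have hb' : 1 - ENNReal.ofReal a = ENNReal.ofReal b := by
      rw [← ENNReal.ofReal_one, ← ENNReal.ofReal_sub _ ha]; congr 1; linarith
    refine ⟨_, measurable_mix hp ha1 h₁ h₂, ?_, ?_, ?_⟩
    · simp only [Prod.snd_add, Prod.smul_snd, smul_eq_mul]; positivity
    · refine (cost_mix_le hp hQ hQc μ ε R ha1 h₁ h₂).trans ?_
      simp only [Prod.snd_add, Prod.smul_snd, smul_eq_mul]
      rw [hb', ENNReal.ofReal_add (by positivity) (by positivity), ENNReal.ofReal_mul ha,
        ENNReal.ofReal_mul hb]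
      gcongr
    · ext k
      simp only [Prod.fst_add, Prod.smul_fst, Pi.add_apply, Pi.smul_apply, smul_eq_mul, v]
      rw [meanCoord_mix hp ha1 h₁ h₂, ENNReal.toReal_ofReal ha, show 1 - a = b by linarith]
      linear_combination -coord k ν * hab
  have hB : Convex ℝ B := (convex_ball _ _).prod (convex_Iio s)
  have hBo : IsOpen B := Metric.isOpen_ball.prod isOpen_Iio
  have hdisj : Disjoint B E := by
    rw [Set.disjoint_left]
    rintro ⟨w, t⟩ ⟨hw, ht⟩ ⟨κ, hκ, ht0, hc, hv⟩
    simp only [mem_Iio] at ht hc hv hw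
    have : κ ∈ approxSet μ Q ε R ν (ENNReal.ofReal s) n := by
      refine ⟨hκ, hc.trans (ENNReal.ofReal_le_ofReal ht.le), fun k hk => ?_⟩
      have h1 := (norm_le_pi_norm w ⟨k, hk⟩).trans (mem_ball_zero_iff.1 hw).le
      rwa [hv] at h1
    rw [hempty] at this
    exact this
  obtain ⟨f, u, hfB, hfE⟩ := geometric_hahn_banach_open hB hBo hE hdisj
  set a := f (0, 1) with ha
  have hB0 : ∀ t < s, a * t < u := fun t ht => by
    have := hfB (0, t) ⟨by simpa using hn, ht⟩
    rw [clm_prod_apply] at this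
    simpa using this
  have hE0 : ∀ κ : X → Pp p d, Measurable κ → ∀ t : ℝ, 0 ≤ t →
      cost μ Q ε R κ ≤ ENNReal.ofReal t →
      u ≤ ∑ k, f (Pi.single k 1, 0) * (meanCoord μ κ k - coord k ν) + a * t :=
    fun κ hκ t ht hc => by
      have := hfE (v κ, t) ⟨κ, hκ, ht, hc, rfl⟩
      rwa [clm_prod_apply] at this
  have ha0 : 0 ≤ a := by
    by_contra hneg
    rw [not_le] at hneg
    have h1 := hB0 (min (s - 1) (u / a)) ((min_le_left _ _).trans_lt (by linarith))
    have h2 : a * (u / a) = u := mul_div_cancel₀ u hneg.ne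
    nlinarith [min_le_right (s - 1) (u / a)]
  rcases ha0.eq_or_lt with h0 | hpos
  · have hu : 0 < u := by simpa [← h0] using hB0 (s - 1) (by linarith)
    refine ⟨fun k => s / u * f (Pi.single k 1, 0), fun κ hκ t ht hc => ?_⟩
    have h1 := hE0 κ hκ t ht hc
    rw [← h0, zero_mul, add_zero] at h1
    simp_rw [mul_assoc]
    rw [← Finset.mul_sum]
    have h2 := mul_le_mul_of_nonneg_left h1 (by positivity : 0 ≤ s / u)
    rw [div_mul_cancel₀ _ hu.ne'] at h2
    linarith
  · refine ⟨fun k => a⁻¹ * f (Pi.single k 1, 0), fun κ hκ t ht hc => ?_⟩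
    have h1 := hE0 κ hκ t ht hc
    have h3 : a * s ≤ u := by
      refine le_of_forall_pos_lt_add fun η hη => ?_
      have := hB0 (s - η / a) (by linarith [div_pos hη hpos])
      rw [mul_sub, mul_div_cancel₀ _ hpos.ne'] at this
      linarith
    simp_rw [mul_assoc]
    rw [← Finset.mul_sum]
    have h2 := mul_le_mul_of_nonneg_left (h3.trans h1) (inv_pos.2 hpos).le
    rw [mul_add, ← mul_assoc, ← mul_assoc, inv_mul_cancel₀ hpos.ne'] at h2
    linarith

lemma exists_potential_of_approxSet_empty (hp : 1 ≤ p) {R : ℕ → ℝ} {Q : X × Pp p d → ℝ≥0∞}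
    (hQ : LowerSemicontinuous Q)
    (hQc : ∀ x ρ₁ ρ₂ (t : ℝ≥0∞) (ht : t ≤ 1),
      Q (x, mix t ht ρ₁ ρ₂) ≤ t * Q (x, ρ₁) + (1 - t) * Q (x, ρ₂))
    {ε : ℝ≥0∞} {μ : Measure X} [IsProbabilityMeasure μ] {ν : Pp p d} {s : ℝ} (hs : 0 ≤ s) {n : ℕ}
    (hempty : approxSet μ Q ε R ν (ENNReal.ofReal s) n = ∅) :
    ∃ ψ : Rd d → ℝ, GrowthP p ψ ∧ (∀ y, 0 ≤ ψ y) ∧ ∀ κ : X → Pp p d, Measurable κ →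
      ENNReal.ofReal (s + ∫ y, ψ y ∂ν.1)
        ≤ cost μ Q ε R κ + ∫⁻ x, ENNReal.ofReal (∫ y, ψ y ∂(κ x).1) ∂μ := by
  obtain ⟨c, hc⟩ := exists_coeff_of_approxSet_empty hp hQ hQc hs hempty
  set L : ℝ := ∑ k, |c k| * testBound d k with hL
  let ψ : Rd d → ℝ := fun y => ∑ k, c k * (testFn d k y : ℝ) + L
  have hg : ∀ k : Fin n, GrowthP p fun y : Rd d => c k * (testFn d k y : ℝ) :=
    fun k => GrowthP.const_mul (growthP_testFn k) (c k)
  have hsum : GrowthP p fun y : Rd d => ∑ k, c k * (testFn d k y : ℝ) := GrowthP.sum _ hg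
  have hψ : GrowthP p ψ := GrowthP.add hsum (growthP_const L)
  have hψ0 : ∀ y, 0 ≤ ψ y := fun y => by
    have : -L ≤ ∑ k, c k * (testFn d k y : ℝ) := by
      rw [hL, ← Finset.sum_neg_distrib]
      refine Finset.sum_le_sum fun k _ => ?_
      have h1 : (testFn d k y : ℝ) ≤ testBound d k := testFn_le k y
      have h2 := mul_le_mul_of_nonneg_left h1 (abs_nonneg (c k))
      have h3 := mul_le_mul_of_nonneg_right (neg_abs_le (c k)) (testFn d k y).coe_nonneg
      linarith
    change 0 ≤ ∑ k, c k * (testFn d k y : ℝ) + L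
    linarith
  have hint : ∀ ρ : Pp p d, ∫ y, ψ y ∂ρ.1 = ∑ k : Fin n, c k * coord k ρ + L := fun ρ => by
    simp only [ψ]
    rw [integral_add (GrowthP.integrable' hsum hp ρ) (integrable_const L),
      integral_finsetSum _ fun k _ => GrowthP.integrable' (hg k) hp ρ]
    simp only [integral_const_mul]
    simp [coord]
  refine ⟨ψ, hψ, hψ0, fun κ hκ => ?_⟩
  have hi : ∫⁻ x, ENNReal.ofReal (∫ y, ψ y ∂(κ x).1) ∂μ
      = ENNReal.ofReal (∑ k : Fin n, c k * meanCoord μ κ k + L) := by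
    have hI : ∀ k : Fin n, Integrable (fun x => c k * coord k (κ x)) μ :=
      fun k => (integrable_coord hκ k).const_mul _
    rw [← ofReal_integral_eq_lintegral_ofReal]
    · simp_rw [hint]
      rw [integral_add (integrable_finsetSum _ fun k _ => hI k) (integrable_const L),
        integral_finsetSum _ fun k _ => hI k]
      simp only [integral_const_mul]
      simp [meanCoord]
    · simp_rw [hint]
      exact (integrable_finsetSum _ fun k _ => hI k).add (integrable_const L)
    · exact Eventually.of_forall fun x => integral_nonneg hψ0
  rcases eq_or_ne (cost μ Q ε R κ) ⊤ with htop | hfin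
  · simp [htop]
  have h1 := hc κ hκ (cost μ Q ε R κ).toReal ENNReal.toReal_nonneg (by rw [ENNReal.ofReal_toReal hfin])
  rw [hi, ← ENNReal.ofReal_toReal hfin, hint]
  refine le_trans (ENNReal.ofReal_le_ofReal ?_) ENNReal.ofReal_add_le
  simp_rw [mul_sub] at h1
  rw [Finset.sum_sub_distrib] at h1
  linarith

end WeakTransport

namespace WeakTransport

variable {p : ℝ} {d : ℕ} {X : Type*}

lemma ofReal_integral_add_penalty (hp : 1 ≤ p) {ψ : Rd d → ℝ} (hψ : GrowthP p ψ)
    (h0 : ∀ y, 0 ≤ ψ y) {e : ℝ} (he : 0 ≤ e) (R : ℕ → ℝ) (m : ℕ) :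
    GrowthP p (fun y : Rd d => ψ y + ∑ j ∈ Finset.range m, e * max (wt p y - R j) 0) ∧
    ∀ ρ : Pp p d,
      ENNReal.ofReal (∫ y, (ψ y + ∑ j ∈ Finset.range m, e * max (wt p y - R j) 0) ∂ρ.1)
        = ENNReal.ofReal (∫ y, ψ y ∂ρ.1) + ENNReal.ofReal e * tailSum R m ρ := by
  have hg : ∀ j : ℕ, GrowthP p fun y : Rd d => e * max (wt p y - R j) 0 :=
    fun j => GrowthP.const_mul (growthP_pos_wt_sub hp (R j)) e
  have hs : GrowthP p fun y : Rd d => ∑ j ∈ Finset.range m, e * max (wt p y - R j) 0 :=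
    GrowthP.sum _ hg
  refine ⟨GrowthP.add hψ hs, fun ρ => ?_⟩
  rw [integral_add (GrowthP.integrable' hψ hp ρ) (GrowthP.integrable' hs hp ρ),
    integral_finsetSum _ fun j _ => GrowthP.integrable' (hg j) hp ρ]
  simp only [integral_const_mul]
  have hn : ∀ j, 0 ≤ ∫ y, max (wt p y - R j) 0 ∂ρ.1 :=
    fun j => integral_nonneg fun y => by exact le_max_right _ _
  rw [ENNReal.ofReal_add (integral_nonneg h0)
    (Finset.sum_nonneg fun j _ => mul_nonneg he (hn j)), ← Finset.mul_sum, ENNReal.ofReal_mul he,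
    ENNReal.ofReal_sum_of_nonneg fun j _ => hn j]
  simp_rw [tailSum, tail_eq hp]

lemma exists_potential_of_lt_primal [MeasurableSpace X] [TopologicalSpace X]
    [OpensMeasurableSpace X] [FirstCountableTopology X] (hp : 1 ≤ p)
    {μ : Measure X} [IsProbabilityMeasure μ] (ν : Pp p d) {C : X → Measure (Rd d) → ℝ≥0∞}
    (hlsc : LowerSemicontinuous fun q : X × Pp p d => C q.1 q.2.1)
    (hconv : ∀ x : X, ∀ ρ₁ ρ₂ : Pp p d, ∀ t : ℝ≥0∞, t ≤ 1 →
      C x (t • ρ₁.1 + (1 - t) • ρ₂.1) ≤ t * C x ρ₁.1 + (1 - t) * C x ρ₂.1)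
    {s : ℝ} (hs : 0 ≤ s) (hlt : ENNReal.ofReal s < primal μ ν.1 C) {η : ℝ} (hη : 0 < η) :
    ∃ ψ : Rd d → ℝ, GrowthP p ψ ∧ (∀ y, 0 ≤ ψ y) ∧ ∃ g : X → ℝ≥0∞,
      (∀ x (ρ : Pp p d), g x ≤ ENNReal.ofReal (∫ y, ψ y ∂ρ.1) + C x ρ.1) ∧
      ENNReal.ofReal (s + ∫ y, ψ y ∂ν.1) ≤ ∫⁻ x, g x ∂μ + ENNReal.ofReal η := by
  obtain ⟨R, hR, -, hRν⟩ := exists_levels hp ν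
  set Q : X × Pp p d → ℝ≥0∞ := fun q => C q.1 q.2.1 with hQ
  have he : 0 < η / 4 := by positivity
  set ε : ℝ≥0∞ := ENNReal.ofReal (η / 4) with hε
  have hε0 : ε ≠ 0 := (ENNReal.ofReal_pos.2 he).ne'
  have hε1 : ε ≠ ⊤ := ENNReal.ofReal_ne_top
  have hQc : ∀ x ρ₁ ρ₂ (t : ℝ≥0∞) (ht : t ≤ 1),
      Q (x, mix t ht ρ₁ ρ₂) ≤ t * Q (x, ρ₁) + (1 - t) * Q (x, ρ₂) :=
    fun x ρ₁ ρ₂ t ht => hconv x ρ₁ ρ₂ t ht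
  obtain ⟨n, hn⟩ : ∃ n, approxSet μ Q ε R ν (ENNReal.ofReal s) n = ∅ := by
    by_contra hcon
    push Not at hcon
    obtain ⟨κ, hκ, hcost, hmean⟩ := exists_of_approxSet_nonempty hp hR hlsc hQc hε0 hε1
      ENNReal.ofReal_ne_top hcon
    have h1 := primal_le_of_kernel hp (ν := ν.1) C hκ hmean
    refine absurd (hlt.trans_le (h1.trans (le_trans (lintegral_mono fun x => ?_) hcost))) (lt_irrefl _)
    exact le_self_add
  obtain ⟨ψ, hψ, hψ0, hdual⟩ := exists_potential_of_approxSet_empty hp hlsc hQc hs hn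
  let Q' : X × Pp p d → ℝ≥0∞ := fun q => Q q + ENNReal.ofReal (∫ y, ψ y ∂q.2.1)
  have hcψ : Continuous fun ρ : Pp p d => ENNReal.ofReal (∫ y, ψ y ∂ρ.1) :=
    ENNReal.continuous_ofReal.comp (continuous_integral_growthP hψ)
  have hQ' : LowerSemicontinuous Q' :=
    LowerSemicontinuous.add hlsc (hcψ.comp continuous_snd).lowerSemicontinuous
  have hQ'c : ∀ x ρ₁ ρ₂, Q' (x, mid ρ₁ ρ₂) ≤ 2⁻¹ * Q' (x, ρ₁) + 2⁻¹ * Q' (x, ρ₂) :=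
    fun x ρ₁ ρ₂ => by
      have h1 := hQc x ρ₁ ρ₂ 2⁻¹ (ENNReal.inv_le_one.2 one_le_two)
      rw [ENNReal.one_sub_inv_two] at h1
      have h2 : ENNReal.ofReal (∫ y, ψ y ∂(mid ρ₁ ρ₂).1)
          = 2⁻¹ * ENNReal.ofReal (∫ y, ψ y ∂ρ₁.1) + 2⁻¹ * ENNReal.ofReal (∫ y, ψ y ∂ρ₂.1) := by
        simp_rw [← lintegral_ofReal_growthP hψ hp hψ0]
        rw [mid, mix, lintegral_mix, ENNReal.one_sub_inv_two]
      refine (add_le_add h1 h2.le).trans_eq ?_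
      simp only [Q']
      ring
  set A := ENNReal.ofReal (s + ∫ y, ψ y ∂ν.1) with hA
  have hAH : A ≤ ∫⁻ x, penVal Q' ε R x ∂μ + ENNReal.ofReal (η / 4) := by
    by_cases hfin : ∫⁻ x, penVal Q' ε R x ∂μ = ⊤
    · rw [hfin, top_add]; exact le_top
    have he8 : 0 < η / 8 := by positivity
    obtain ⟨κ, hκ, hle⟩ := exists_measurable_selection hp hR hQ' hQ'c hε0 hε1 hfin
      (ENNReal.ofReal_pos.2 he8).ne' ENNReal.ofReal_ne_top
    refine (hdual κ hκ).trans ?_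
    unfold cost
    rw [← lintegral_add_left (measurable_cost_integrand hp hlsc ε R hκ)]
    refine le_trans (le_of_eq (lintegral_congr fun x => ?_)) (hle.trans_eq ?_)
    · simp only [Q']; ring
    · congr 1
      rw [show (2 : ℝ≥0∞) = ENNReal.ofReal 2 by simp, ← ENNReal.ofReal_mul he8.le]
      congr 1
      ring
  have hsup : ∫⁻ x, penVal Q' ε R x ∂μ = ⨆ m, ∫⁻ x, lscHull (partVal Q' ε R m) x ∂μ := by
    rw [← lintegral_iSup (fun m => (lowerSemicontinuous_lscHull _).measurable)
      fun m n h x => lscHull_mono (fun x => partVal_mono Q' ε R x h) x]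
    exact lintegral_congr fun x => penVal_eq_iSup hp hR hQ' hε0 hε1 x
  obtain ⟨m, hm⟩ : ∃ m, A < ∫⁻ x, lscHull (partVal Q' ε R m) x ∂μ + ENNReal.ofReal (η / 2) := by
    rw [← lt_iSup_iff, ← ENNReal.iSup_add, ← hsup]
    by_cases hfin : ∫⁻ x, penVal Q' ε R x ∂μ = ⊤
    · rw [hfin, top_add]; exact ENNReal.ofReal_lt_top
    · exact hAH.trans_lt (ENNReal.add_lt_add_left hfin
        ((ENNReal.ofReal_lt_ofReal_iff (by positivity)).2 (by linarith)))
  obtain ⟨hg, hint⟩ := ofReal_integral_add_penalty hp hψ hψ0 he.le R m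
  refine ⟨_, hg, fun y => add_nonneg (hψ0 y) (Finset.sum_nonneg fun j _ => by positivity),
    lscHull (partVal Q' ε R m), fun x ρ => ?_, ?_⟩
  · rw [hint]
    refine (lscHull_le _ x).trans ((iInf_le _ ρ).trans_eq ?_)
    simp only [Q', Q]
    ring
  · rw [ENNReal.ofReal_add hs
      (integral_nonneg fun y => add_nonneg (hψ0 y) (Finset.sum_nonneg fun j _ => by positivity)),
      hint, ← add_assoc, ← ENNReal.ofReal_add hs (integral_nonneg hψ0)]
    calc A + ε * tailSum R m ν
        ≤ (∫⁻ x, lscHull (partVal Q' ε R m) x ∂μ + ENNReal.ofReal (η / 2)) + ε * 1 := by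
          gcongr
          exact (tailSum_le_tailSeries R m ν).trans hRν
      _ ≤ ∫⁻ x, lscHull (partVal Q' ε R m) x ∂μ + ENNReal.ofReal η := by
          rw [mul_one, add_assoc, ← ENNReal.ofReal_add (by positivity) he.le]
          gcongr
          linarith

end WeakTransport

namespace WeakTransport

variable {p : ℝ} {d : ℕ}

/-- The measure obtained from `ρ` by replacing, for every `n ∈ s`, the mass in `A n` by the
same amount of mass distributed according to `σ n`. -/
noncomputable def splice (ρ : Pp p d) (A : ℕ → Set (Rd d)) (σ : ℕ → Pp p d) (s : Finset ℕ) :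
    Measure (Rd d) :=
  ρ.1.restrict (⋃ n ∈ s, A n)ᶜ + ∑ n ∈ s, ρ.1 (A n) • (σ n).1

variable {ρ : Pp p d} {A : ℕ → Set (Rd d)} {σ : ℕ → Pp p d} {s : Finset ℕ}

lemma lintegral_splice (f : Rd d → ℝ≥0∞) :
    ∫⁻ y, f y ∂(splice ρ A σ s) =
      ∫⁻ y in (⋃ n ∈ s, A n)ᶜ, f y ∂ρ.1 + ∑ n ∈ s, ρ.1 (A n) * ∫⁻ y, f y ∂(σ n).1 := by
  rw [splice, lintegral_add_measure, lintegral_finsetSum_measure]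
  simp_rw [lintegral_smul_measure, smul_eq_mul]

lemma isProbabilityMeasure_splice (hA : ∀ n, MeasurableSet (A n))
    (hd : (s : Set ℕ).PairwiseDisjoint A) : IsProbabilityMeasure (splice ρ A σ s) := by
  refine ⟨?_⟩
  rw [← lintegral_one, lintegral_splice]
  simp only [lintegral_one, measure_univ, mul_one, Measure.restrict_apply_univ]
  rw [← measure_biUnion_finset hd fun n _ => hA n, add_comm]
  exact prob_add_prob_compl (s.measurableSet_biUnion fun n _ => hA n)

lemma hasMomentP_splice : HasMomentP p (splice ρ A σ s) := by
  rw [HasMomentP, lintegral_splice]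
  refine ENNReal.add_ne_top.2 ⟨ne_top_of_le_ne_top ρ.2.2 (setLIntegral_le_lintegral _ _),
    ENNReal.sum_ne_top.2 fun n _ => ENNReal.mul_ne_top (measure_ne_top _ _) (σ n).2.2⟩

/-- Comparison of integrals under splicing. -/
lemma integral_le_integral_splice (hA : ∀ n, MeasurableSet (A n))
    (hd : (s : Set ℕ).PairwiseDisjoint A) {f g : Rd d → ℝ} (hf : Integrable f ρ.1)
    (hg : Integrable g (splice ρ A σ s))
    (hle : ∀ n ∈ s, Integrable g (σ n).1 → ∀ y ∈ A n, f y ≤ ∫ z, g z ∂(σ n).1) :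
    ∫ y, f y ∂ρ.1 - ∫ y in (⋃ n ∈ s, A n)ᶜ, f y ∂ρ.1 ≤
      ∫ y, g y ∂(splice ρ A σ s) - ∫ y in (⋃ n ∈ s, A n)ᶜ, g y ∂ρ.1 := by
  have hU : MeasurableSet (⋃ n ∈ s, A n) := s.measurableSet_biUnion fun n _ => hA n
  rw [splice, integrable_add_measure] at hg
  have hg2 := integrable_finsetSum_measure.1 hg.2
  rw [splice, integral_add_measure hg.1 hg.2, integral_finsetSum_measure hg2, add_sub_cancel_left,
    ← integral_add_compl hU hf, add_sub_cancel_right,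
    integral_biUnion_finset s (fun n _ => hA n) hd fun n _ => hf.integrableOn]
  refine Finset.sum_le_sum fun n hn => ?_
  by_cases h0 : ρ.1 (A n) = 0
  · rw [setIntegral_measure_zero _ h0, h0]
    simp
  have hgn := (integrable_smul_measure h0 (measure_ne_top _ _)).1 (hg2 n hn)
  rw [integral_smul_measure, smul_eq_mul]
  refine (setIntegral_mono_on hf.integrableOn (integrable_const _) (hA n)
    (hle n hn hgn)).trans_eq ?_
  simp [Measure.real]

lemma erealToENN_coe (r : ℝ) : erealToENN (r : EReal) = ENNReal.ofReal r := by
  simp [erealToENN]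

lemma eInt_coe {ρ : Measure (Rd d)} {f : Rd d → ℝ} (hf : Integrable f ρ) :
    eInt ρ (fun y => (f y : EReal)) = ((∫ y, f y ∂ρ : ℝ) : EReal) := by
  have h1 : ∫⁻ y, ENNReal.ofReal (f y) ∂ρ ≠ ⊤ := hf.lintegral_lt_top.ne
  have h2 : ∫⁻ y, ENNReal.ofReal (-f y) ∂ρ ≠ ⊤ := hf.neg.lintegral_lt_top.ne
  rw [integral_eq_lintegral_pos_part_sub_lintegral_neg_part hf, EReal.coe_sub,
    EReal.coe_ennreal_toReal h1, EReal.coe_ennreal_toReal h2]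
  simp_rw [eInt, ← EReal.coe_neg, erealToENN_coe]

lemma convexOn_continuous {f : Rd d → ℝ} (hf : ConvexOn ℝ univ f) : Continuous f :=
  continuousOn_univ.1 (hf.continuousOn isOpen_univ)

/-- A finite convex function is bounded from below by a function of linear growth. -/
lemma exists_neg_le_of_convexOn {f : Rd d → ℝ} (hf : ConvexOn ℝ univ f) :
    ∃ K : ℝ, ∀ y, -f y ≤ K * (1 + ‖y‖) := by
  obtain ⟨M, hM⟩ := (isCompact_closedBall (0 : Rd d) 1).exists_bound_of_continuousOn
    (convexOn_continuous hf).continuousOn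
  refine ⟨|f 0| + |M|, fun y => ?_⟩
  have hy : (0 : ℝ) < 1 + ‖y‖ := by positivity
  set w : Rd d := -(‖y‖⁻¹ • y) with hw
  have hwn : ‖w‖ ≤ 1 := by
    rw [hw, norm_neg, norm_smul, norm_inv, norm_norm]
    exact inv_mul_le_one
  have hfw : f w ≤ |M| := (le_abs_self _).trans
    ((hM w (by simpa using hwn)).trans (le_abs_self M))
  have h0 : f ((1 / (1 + ‖y‖)) • y + (‖y‖ / (1 + ‖y‖)) • w)
      ≤ (1 / (1 + ‖y‖)) • f y + (‖y‖ / (1 + ‖y‖)) • f w :=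
    hf.2 (mem_univ y) (mem_univ w) (by positivity) (by positivity) (by field_simp)
  have hz : (1 / (1 + ‖y‖)) • y + (‖y‖ / (1 + ‖y‖)) • w = 0 := by
    rcases eq_or_ne y 0 with rfl | hne
    · simp
    · have : ‖y‖ ≠ 0 := norm_ne_zero_iff.2 hne
      rw [hw, smul_neg, smul_smul, ← sub_eq_add_neg, ← sub_smul]
      convert zero_smul ℝ y using 2
      field_simp
      ring
  rw [hz, smul_eq_mul, smul_eq_mul] at h0
  have h1 : (1 + ‖y‖) * f 0 ≤ f y + ‖y‖ * f w := by
    calc (1 + ‖y‖) * f 0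
        ≤ (1 + ‖y‖) * (1 / (1 + ‖y‖) * f y + ‖y‖ / (1 + ‖y‖) * f w) := by gcongr
      _ = f y + ‖y‖ * f w := by field_simp
  nlinarith [neg_abs_le (f 0), norm_nonneg y, abs_nonneg M,
    mul_le_mul_of_nonneg_left hfw (norm_nonneg y),
    mul_le_mul_of_nonneg_left (neg_abs_le (f 0)) hy.le]

lemma lintegral_neg_ne_top_of_convexOn (hp : 1 ≤ p) {f : Rd d → ℝ} (hf : ConvexOn ℝ univ f)
    (ρ : Pp p d) : ∫⁻ y, ENNReal.ofReal (-f y) ∂ρ.1 ≠ ⊤ := by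
  obtain ⟨K, hK⟩ := exists_neg_le_of_convexOn hf
  have hg : GrowthP p fun y : Rd d => K * (1 + ‖y‖) :=
    GrowthP.const_mul (GrowthP.add (growthP_const 1) (growthP_norm hp)) K
  exact ne_top_of_le_ne_top (GrowthP.integrable' hg hp ρ).lintegral_lt_top.ne
    (lintegral_mono fun y => ENNReal.ofReal_le_ofReal (hK y))

lemma integrable_of_convexOn (hp : 1 ≤ p) {f : Rd d → ℝ} (hf : ConvexOn ℝ univ f) (ρ : Pp p d)
    (h : ∫⁻ y, ENNReal.ofReal (f y) ∂ρ.1 ≠ ⊤) : Integrable f ρ.1 := by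
  refine ⟨(convexOn_continuous hf).aestronglyMeasurable, ?_⟩
  rw [hasFiniteIntegral_iff_norm]
  have hle : ∀ y, ENNReal.ofReal ‖f y‖ ≤ ENNReal.ofReal (f y) + ENNReal.ofReal (-f y) := fun y => by
    rcases le_total 0 (f y) with h | h
    · rw [Real.norm_of_nonneg h]; exact le_self_add
    · rw [Real.norm_of_nonpos h]; exact le_add_self
  refine (lintegral_mono hle).trans_lt ?_
  rw [lintegral_add_left (convexOn_continuous hf).measurable.ennreal_ofReal]
  exact ENNReal.add_lt_top.2 ⟨h.lt_top, (lintegral_neg_ne_top_of_convexOn hp hf ρ).lt_top⟩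

/-- Jensen's inequality for increasing convex functions. -/
lemma le_integral_of_le_mean (hp : 1 ≤ p) {f : Rd d → ℝ} (hf : ConvexOn ℝ univ f)
    (hm : CoordMono f) (σ : Pp p d) (hfi : Integrable f σ.1) {y : Rd d}
    (hy : ∀ i, y i ≤ ∫ z : Rd d, z i ∂σ.1) : f y ≤ ∫ z, f z ∂σ.1 := by
  have hid : Integrable (fun z : Rd d => z) σ.1 :=
    (integrable_norm_iff continuous_id.aestronglyMeasurable).1
      (GrowthP.integrable' (growthP_norm hp) hp σ)
  refine (hm y (∫ z, z ∂σ.1) fun i => ?_).trans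
    (hf.map_integral_le (convexOn_continuous hf).continuousOn isClosed_univ
      (by simp) hid hfi)
  refine (hy i).trans_eq ?_
  exact (EuclideanSpace.proj (𝕜 := ℝ) i).integral_comp_comm hid

lemma icxOrder_splice (hp : 1 ≤ p) (hA : ∀ n, MeasurableSet (A n))
    (hd : (s : Set ℕ).PairwiseDisjoint A)
    (hmean : ∀ n ∈ s, ∀ y ∈ A n, ∀ i, y i ≤ ∫ z : Rd d, z i ∂(σ n).1) :
    IcxOrder ρ.1 (splice ρ A σ s) := by
  intro f hf hm
  let ρ' : Pp p d := ⟨splice ρ A σ s, isProbabilityMeasure_splice hA hd, hasMomentP_splice⟩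
  have hU : MeasurableSet (⋃ n ∈ s, A n) := s.measurableSet_biUnion fun n _ => hA n
  by_cases htop : ∫⁻ y, ENNReal.ofReal (f y) ∂ρ'.1 = ⊤
  · have h2 := lintegral_neg_ne_top_of_convexOn hp hf ρ'
    have h3 : eInt ρ'.1 (fun y => (f y : EReal)) = ⊤ := by
      simp_rw [eInt, ← EReal.coe_neg, erealToENN_coe]
      rw [htop, ← EReal.coe_ennreal_toReal h2, EReal.coe_ennreal_top, EReal.top_sub_coe]
    exact le_top.trans_eq h3.symm
  have hi : Integrable f (splice ρ A σ s) := integrable_of_convexOn hp hf ρ' htop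
  have hle : ∀ n ∈ s, Integrable f (σ n).1 → ∀ y ∈ A n, f y ≤ ∫ z, f z ∂(σ n).1 :=
    fun n hn hfi y hy => le_integral_of_le_mean hp hf hm (σ n) hfi (hmean n hn y hy)
  have hi' : Integrable f ρ.1 := by
    refine integrable_of_convexOn hp hf ρ ?_
    rw [← lintegral_add_compl _ hU]
    have h1 := hi
    rw [splice, integrable_add_measure] at h1
    have h2 := integrable_finsetSum_measure.1 h1.2
    refine ENNReal.add_ne_top.2 ⟨?_, h1.1.lintegral_lt_top.ne⟩
    rw [lintegral_biUnion_finset hd fun n _ => hA n]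
    refine ENNReal.sum_ne_top.2 fun n hn => ?_
    by_cases h0 : ρ.1 (A n) = 0
    · rw [setLIntegral_measure_zero _ _ h0]; exact ENNReal.zero_ne_top
    have h3 := hle n hn ((integrable_smul_measure h0 (measure_ne_top _ _)).1 (h2 n hn))
    refine ne_top_of_le_ne_top ?_ (setLIntegral_mono' (hA n)
      fun y hy => ENNReal.ofReal_le_ofReal (h3 y hy))
    rw [setLIntegral_const]
    exact ENNReal.mul_ne_top ENNReal.ofReal_ne_top (measure_ne_top _ _)
  rw [eInt_coe hi, eInt_coe hi', EReal.coe_le_coe_iff]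
  exact (sub_le_sub_iff_right _).1 (integral_le_integral_splice hA hd hi' hi hle)

end WeakTransport

namespace WeakTransport

variable {p : ℝ} {d : ℕ} {ψ : Rd d → ℝ}

/-- The increasing convex envelope of a potential. -/
noncomputable def envelope (p : ℝ) (ψ : Rd d → ℝ) (y : Rd d) : ℝ :=
  ⨅ σ : {σ : Pp p d // ∀ i, y i ≤ ∫ z : Rd d, z i ∂σ.1}, ∫ z, ψ z ∂σ.1.1

lemma envelope_le (h0 : ∀ y, 0 ≤ ψ y) {y : Rd d} (σ : Pp p d)
    (h : ∀ i, y i ≤ ∫ z : Rd d, z i ∂σ.1) : envelope p ψ y ≤ ∫ z, ψ z ∂σ.1 :=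
  ciInf_le (f := fun σ : {σ : Pp p d // ∀ i, y i ≤ ∫ z : Rd d, z i ∂σ.1} => ∫ z, ψ z ∂σ.1.1)
    ⟨0, by rintro _ ⟨σ, rfl⟩; exact integral_nonneg h0⟩ ⟨σ, h⟩

lemma le_integral_diracPp (y : Rd d) (i : Fin d) : y i ≤ ∫ z : Rd d, z i ∂(diracPp p y).1 := by
  simp [diracPp]

instance nonempty_mean_ge (y : Rd d) :
    Nonempty {σ : Pp p d // ∀ i, y i ≤ ∫ z : Rd d, z i ∂σ.1} :=
  ⟨⟨diracPp p y, le_integral_diracPp y⟩⟩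

lemma envelope_nonneg (h0 : ∀ y, 0 ≤ ψ y) (y : Rd d) : 0 ≤ envelope p ψ y :=
  le_ciInf fun _ => integral_nonneg h0

lemma envelope_le_self (h0 : ∀ y, 0 ≤ ψ y) (y : Rd d) : envelope p ψ y ≤ ψ y :=
  (envelope_le h0 (diracPp p y) (le_integral_diracPp y)).trans_eq (by simp [diracPp])

lemma exists_of_envelope_lt {y : Rd d} {c : ℝ} (h : envelope p ψ y < c) :
    ∃ σ : Pp p d, (∀ i, y i ≤ ∫ z : Rd d, z i ∂σ.1) ∧ ∫ z, ψ z ∂σ.1 < c := by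
  obtain ⟨⟨σ, hσ⟩, h1⟩ := exists_lt_of_ciInf_lt h
  exact ⟨σ, hσ, h1⟩

lemma coordMono_envelope (h0 : ∀ y, 0 ≤ ψ y) : CoordMono (envelope p ψ) := fun _ _ h =>
  le_ciInf fun σ => envelope_le h0 σ.1 fun i => (h i).trans (σ.2 i)

lemma convexOn_envelope (hp : 1 ≤ p) (hψ : GrowthP p ψ) (h0 : ∀ y, 0 ≤ ψ y) :
    ConvexOn ℝ univ (envelope p ψ) := by
  refine ⟨convex_univ, fun y _ z _ a b ha hb hab => le_of_forall_pos_le_add fun e he => ?_⟩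
  obtain ⟨σ, hσ, hσ'⟩ := exists_of_envelope_lt (lt_add_of_pos_right (envelope p ψ y) he)
  obtain ⟨τ, hτ, hτ'⟩ := exists_of_envelope_lt (lt_add_of_pos_right (envelope p ψ z) he)
  have ha1 : ENNReal.ofReal a ≤ 1 := ENNReal.ofReal_le_one.2 (by linarith)
  have hmix : ∀ {f : Rd d → ℝ}, GrowthP p f → ∫ y, f y ∂(mix (ENNReal.ofReal a) ha1 σ τ).1 =
      a * ∫ y, f y ∂σ.1 + b * ∫ y, f y ∂τ.1 := fun hf => by
    rw [integral_mix ha1 σ τ hf hp, ENNReal.toReal_ofReal ha, ← hab, add_sub_cancel_left]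
  refine (envelope_le h0 (mix _ ha1 σ τ) fun i => ?_).trans ?_
  · rw [hmix (growthP_coord hp i)]
    simp only [PiLp.add_apply, PiLp.smul_apply, smul_eq_mul]
    gcongr
    exacts [hσ i, hτ i]
  · rw [hmix hψ, smul_eq_mul, smul_eq_mul]
    have hb' : b = 1 - a := by linarith
    nlinarith [mul_le_mul_of_nonneg_left hσ'.le ha, mul_le_mul_of_nonneg_left hτ'.le hb]

lemma growthP_envelope (hp : 1 ≤ p) (hψ : GrowthP p ψ) (h0 : ∀ y, 0 ≤ ψ y) :
    GrowthP p (envelope p ψ) := by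
  obtain ⟨K, hK⟩ := hψ.2
  refine ⟨convexOn_continuous (convexOn_envelope hp hψ h0), K, fun y => ?_⟩
  rw [abs_of_nonneg (envelope_nonneg h0 y)]
  exact (envelope_le_self h0 y).trans ((le_abs_self _).trans (hK y))

lemma cbp_of_growthP {f : Rd d → ℝ} (hf : GrowthP p f) (h0 : ∀ y, 0 ≤ f y) : Cbp p f := by
  obtain ⟨K, hK⟩ := hf.2
  refine ⟨hf.1, ⟨0, h0⟩, |K| + 1, by positivity, 0, fun y => ?_⟩
  rw [sub_zero]
  refine (le_abs_self _).trans ((hK y).trans ?_)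
  gcongr
  linarith [le_abs_self K]

/-- Near-optimal measures for the envelope can be chosen from a countable family, locally
uniformly. -/
lemma exists_cover (hp : 1 ≤ p) (hψ : GrowthP p ψ) (h0 : ∀ y, 0 ≤ ψ y) {e : ℝ} (he : 0 < e) :
    ∃ (σ : ℕ → Pp p d) (U : ℕ → Set (Rd d)), (∀ n, IsOpen (U n)) ∧ ⋃ n, U n = univ ∧
      ∀ n, ∀ y ∈ U n, (∀ i, y i ≤ ∫ z : Rd d, z i ∂(σ n).1) ∧
        ∫ z, ψ z ∂(σ n).1 ≤ envelope p ψ y + e := by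
  have hc : Continuous (envelope p ψ) := (growthP_envelope hp hψ h0).1
  let V : Pp p d → Set (Rd d) := fun σ =>
    {y | (∀ i, y i < ∫ z : Rd d, z i ∂σ.1) ∧ ∫ z, ψ z ∂σ.1 < envelope p ψ y + e}
  have hV : ∀ σ, IsOpen (V σ) := fun σ => by
    refine IsOpen.and ?_ (isOpen_lt continuous_const (hc.add continuous_const))
    simp only [Set.ofPred_forall]
    exact isOpen_iInter_of_finite fun i => isOpen_lt (by fun_prop) continuous_const
  have hVu : ⋃ σ, V σ = univ := by
    refine eq_univ_of_forall fun y => mem_iUnion.2 ?_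
    let v : Rd d := WithLp.toLp 2 fun _ => 1
    have ht : Tendsto (fun t : ℝ => envelope p ψ (y + t • v)) (𝓝[>] 0) (𝓝 (envelope p ψ y)) := by
      have h1 : Continuous fun t : ℝ => envelope p ψ (y + t • v) := hc.comp (by fun_prop)
      simpa using (h1.tendsto 0).mono_left nhdsWithin_le_nhds
    obtain ⟨t, ht1, ht0⟩ := ((ht.eventually_lt_const (lt_add_of_pos_right _ he)).and
      self_mem_nhdsWithin).exists
    obtain ⟨σ, h1, h2⟩ := exists_of_envelope_lt ht1
    refine ⟨σ, fun i => lt_of_lt_of_le ?_ (h1 i), h2⟩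
    have : (0 : ℝ) < t := ht0
    simpa [v] using this
  obtain ⟨T, hT, hTu⟩ := TopologicalSpace.isOpen_iUnion_countable V hV
  have hne : T.Nonempty := by
    by_contra hcon
    rw [not_nonempty_iff_eq_empty.1 hcon, hVu] at hTu
    simpa using hTu.symm.subset (mem_univ (0 : Rd d))
  obtain ⟨σ, rfl⟩ := hT.exists_eq_range hne
  refine ⟨σ, fun n => V (σ n), fun n => hV _, ?_, fun n y hy => ⟨fun i => (hy.1 i).le, hy.2.le⟩⟩
  rw [← hVu, ← hTu, biUnion_range]

lemma exists_icxOrder_integral_le (hp : 1 ≤ p) (hψ : GrowthP p ψ) (h0 : ∀ y, 0 ≤ ψ y)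
    (ρ : Pp p d) {e : ℝ} (he : 0 < e) : ∃ ρ' : Pp p d, IcxOrder ρ.1 ρ'.1 ∧
      ∫ y, ψ y ∂ρ'.1 ≤ ∫ y, envelope p ψ y ∂ρ.1 + e := by
  have he2 : 0 < e / 2 := by positivity
  obtain ⟨σ, U, hU, hUu, hσ⟩ := exists_cover hp hψ h0 he2
  have hUm : ∀ n, MeasurableSet (disjointed U n) :=
    MeasurableSet.disjointed fun n => (hU n).measurableSet
  have hd : ∀ s : Finset ℕ, (s : Set ℕ).PairwiseDisjoint (disjointed U) :=
    fun s i _ j _ hij => disjoint_disjointed U hij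
  have hsub : ∀ n, disjointed U n ⊆ U n := disjointed_subset U
  have hψi := GrowthP.integrable' hψ hp ρ
  have hφi := GrowthP.integrable' (growthP_envelope hp hψ h0) hp ρ
  have hlim : Tendsto (fun N => ∫ y in (⋃ n ∈ Finset.range N, disjointed U n)ᶜ, ψ y ∂ρ.1) atTop
      (𝓝 0) := by
    have h1 := tendsto_setIntegral_of_antitone (μ := ρ.1) (f := ψ)
      (s := fun N => (⋃ n ∈ Finset.range N, disjointed U n)ᶜ)
      (fun N => ((Finset.range N).measurableSet_biUnion fun n _ => hUm n).compl)
      (fun M N h => compl_subset_compl.2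
        (biUnion_subset_biUnion_left (Finset.coe_subset.2 (Finset.range_mono h))))
      ⟨0, hψi.integrableOn⟩
    have h2 : ⋂ N, (⋃ n ∈ Finset.range N, disjointed U n)ᶜ = ∅ := by
      rw [← compl_iUnion, compl_empty_iff, eq_univ_iff_forall]
      intro y
      have hy : y ∈ ⋃ n, disjointed U n := by rw [iUnion_disjointed, hUu]; trivial
      obtain ⟨n, hn⟩ := mem_iUnion.1 hy
      exact mem_iUnion.2 ⟨n + 1, mem_biUnion (by simp) hn⟩
    rwa [h2, Measure.restrict_empty, integral_zero_measure] at h1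
  obtain ⟨N, hN⟩ := (hlim.eventually_lt_const he2).exists
  set s := Finset.range N
  let ρ' : Pp p d := ⟨splice ρ (disjointed U) σ s, isProbabilityMeasure_splice hUm (hd s),
    hasMomentP_splice⟩
  refine ⟨ρ', icxOrder_splice hp hUm (hd s) fun n _ y hy => (hσ n y (hsub n hy)).1, ?_⟩
  have hc := integral_le_integral_splice (A := disjointed U) (σ := σ) (s := s) (ρ := ρ)
    (f := fun y => -(envelope p ψ y + e / 2)) (g := fun y => -ψ y) hUm (hd s)
    (hφi.add (integrable_const _)).neg (GrowthP.integrable' hψ hp ρ').neg fun n _ _ y hy => by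
      rw [integral_neg]
      exact neg_le_neg (hσ n y (hsub n hy)).2
  rw [integral_neg, integral_neg, integral_neg, integral_neg,
    integral_add hφi (integrable_const _), integral_const, probReal_univ, one_smul] at hc
  have hB : 0 ≤ ∫ y in (⋃ n ∈ s, disjointed U n)ᶜ, (envelope p ψ y + e / 2) ∂ρ.1 :=
    integral_nonneg fun y => add_nonneg (envelope_nonneg h0 y) he2.le
  change ∫ y, ψ y ∂(splice ρ (disjointed U) σ s) ≤ _
  linarith

/-- Passing to the increasing convex envelope preserves the dual constraint. -/
lemma le_integral_envelope_add {X : Type*} (hp : 1 ≤ p) (hψ : GrowthP p ψ) (h0 : ∀ y, 0 ≤ ψ y)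
    {C : X → Measure (Rd d) → ℝ≥0∞}
    (hmono : ∀ x : X, ∀ ρ₁ ρ₂ : Pp p d, IcxOrder ρ₁.1 ρ₂.1 → C x ρ₂.1 ≤ C x ρ₁.1)
    {g : X → ℝ≥0∞}
    (hg : ∀ x (ρ : Pp p d), g x ≤ ENNReal.ofReal (∫ y, ψ y ∂ρ.1) + C x ρ.1) (x : X)
    (ρ : Pp p d) : g x ≤ ENNReal.ofReal (∫ y, envelope p ψ y ∂ρ.1) + C x ρ.1 := by
  refine ENNReal.le_of_forall_pos_le_add fun e he _ => ?_
  obtain ⟨ρ', hρ', hle⟩ := exists_icxOrder_integral_le hp hψ h0 ρ (NNReal.coe_pos.2 he)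
  refine (hg x ρ').trans ((add_le_add (ENNReal.ofReal_le_ofReal hle)
    (hmono x ρ ρ' hρ')).trans_eq ?_)
  rw [ENNReal.ofReal_add (integral_nonneg (envelope_nonneg h0)) (NNReal.coe_nonneg e), ENNReal.ofReal_coe_nnreal]
  ring

end WeakTransport

namespace WeakTransport

variable {p : ℝ} {d : ℕ} {ψ : Rd d → ℝ}

lemma growthP_of_cbp (hp : 1 ≤ p) (hψ : Cbp p ψ) : GrowthP p ψ := by
  obtain ⟨hc, ⟨c, hl⟩, K, hK, y₀, hu⟩ := hψ
  set D : ℝ := 2 ^ (p - 1)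
  have hD : 0 ≤ D := by positivity
  refine growthP_of_le hc (|c| + K * (1 + D + D * ‖y₀‖ ^ p)) fun y => ?_
  have h1 : ‖y - y₀‖ ^ p ≤ D * (‖y‖ ^ p + ‖y₀‖ ^ p) := by
    have h2 := NNReal.rpow_add_le_mul_rpow_add_rpow ‖y‖₊ ‖y₀‖₊ hp
    have h3 : (‖y‖ + ‖y₀‖) ^ p ≤ D * (‖y‖ ^ p + ‖y₀‖ ^ p) := by exact_mod_cast h2
    exact (Real.rpow_le_rpow (norm_nonneg _) (norm_sub_le _ _) (by linarith)).trans h3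
  have hs : 0 ≤ ‖y₀‖ ^ p := by positivity
  have ht : 0 ≤ ‖y‖ ^ p := by positivity
  have h4 : 1 + ‖y - y₀‖ ^ p ≤ (1 + D + D * ‖y₀‖ ^ p) * wt p y := by
    unfold wt
    nlinarith [mul_nonneg hD ht, mul_nonneg hD hs, mul_nonneg (mul_nonneg hD hs) ht]
  have h5 : ψ y ≤ K * (1 + D + D * ‖y₀‖ ^ p) * wt p y :=
    (hu y).trans ((mul_le_mul_of_nonneg_left h4 hK.le).trans_eq (by ring))
  have h6 : |c| ≤ |c| * wt p y := le_mul_of_one_le_right (abs_nonneg c) (one_le_wt y)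
  have h7 : 0 ≤ K * (1 + D + D * ‖y₀‖ ^ p) * wt p y :=
    mul_nonneg (by positivity) (wt_nonneg y)
  rw [abs_le, add_mul]
  exact ⟨by linarith [hl y, neg_abs_le c], by linarith [abs_nonneg c]⟩

lemma erealToENN_add_le {z : EReal} {a : ℝ} {b : ℝ≥0∞} (h : z ≤ (a : EReal) + b) :
    erealToENN z + ENNReal.ofReal (-a) ≤ erealToENN (-z) + (ENNReal.ofReal a + b) := by
  induction z with
  | bot => simp [erealToENN]
  | top =>
    have hb : b = ⊤ := by
      by_contra hb
      rw [← EReal.coe_ennreal_toReal hb, ← EReal.coe_add, top_le_iff] at h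
      exact EReal.coe_ne_top _ h
    simp [hb]
  | coe z =>
    rcases eq_or_ne b ⊤ with rfl | hb
    · simp
    lift b to NNReal using hb
    have h' : z ≤ a + b := by
      have h1 : (((b : ℝ≥0∞) : EReal)) = ((b : ℝ) : EReal) := rfl
      rw [h1] at h
      exact_mod_cast h
    rw [← EReal.coe_neg, erealToENN_coe, erealToENN_coe, ← ENNReal.ofReal_coe_nnreal]
    simp only [ENNReal.ofReal, ← ENNReal.coe_add, ENNReal.coe_le_coe, ← NNReal.coe_le_coe,
      NNReal.coe_add, Real.coe_toNNReal']
    have hb := b.2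
    rcases le_total z 0 with h1 | h1 <;> rcases le_total a 0 with h2 | h2 <;>
      simp [h1, h2] <;> linarith

variable {X : Type*} [MeasurableSpace X]

lemma conj_le (C : X → Measure (Rd d) → ℝ≥0∞) (ψ : Rd d → ℝ) (x : X) (ρ : Pp p d) :
    conj p C ψ x ≤ ((∫ y, ψ y ∂ρ.1 : ℝ) : EReal) + ((C x ρ.1 : ℝ≥0∞) : EReal) := iInf_le _ ρ

/-- A lower bound for the dual value of a nonnegative potential. -/
lemma le_dualVal {φ : Rd d → ℝ} (h0 : ∀ y, 0 ≤ φ y) {μ : Measure X} (ν : Measure (Rd d))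
    {C : X → Measure (Rd d) → ℝ≥0∞} {g : X → ℝ≥0∞}
    (hg : ∀ x (ρ : Pp p d), g x ≤ ENNReal.ofReal (∫ y, φ y ∂ρ.1) + C x ρ.1) :
    ((∫⁻ x, g x ∂μ : ℝ≥0∞) : EReal) - ((∫ y, φ y ∂ν : ℝ) : EReal) ≤ dualVal p μ ν C φ := by
  have h1 : ∀ x, ((g x : ℝ≥0∞) : EReal) ≤ conj p C φ x := fun x => le_iInf fun ρ => by
    refine (EReal.coe_ennreal_le_coe_ennreal_iff.2 (hg x ρ)).trans_eq ?_
    rw [EReal.coe_ennreal_add, EReal.coe_ennreal_ofReal, max_eq_left (integral_nonneg h0)]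
  have h2 : ∀ x, g x ≤ erealToENN (conj p C φ x) := fun x => by
    have := h1 x
    unfold erealToENN
    split_ifs with h
    · exact le_top
    · have hgx : g x ≠ ⊤ := fun hgx => by
        rw [hgx, EReal.coe_ennreal_top, top_le_iff] at this
        exact h this
      rw [← ENNReal.ofReal_toReal hgx]
      refine ENNReal.ofReal_le_ofReal ?_
      rw [← EReal.toReal_coe_ennreal]
      exact EReal.toReal_le_toReal this (EReal.coe_ennreal_ne_bot _) h
  have h3 : ∀ x, erealToENN (-conj p C φ x) = 0 := fun x => by
    have h4 : -conj p C φ x ≤ 0 := EReal.neg_le_zero.2 ((EReal.coe_ennreal_nonneg _).trans (h1 x))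
    unfold erealToENN
    rw [if_neg (h4.trans_lt EReal.zero_lt_top).ne, ENNReal.ofReal_eq_zero]
    exact EReal.toReal_nonpos h4
  unfold dualVal eInt
  simp_rw [h3, lintegral_zero, EReal.coe_ennreal_zero, sub_zero]
  exact EReal.sub_le_sub (EReal.coe_ennreal_le_coe_ennreal_iff.2 (lintegral_mono h2)) le_rfl

lemma exists_disint_eq (hp : 1 ≤ p) {μ : Measure X} (ν : Pp p d) {π : Measure (X × Rd d)}
    (hπ : IsCoupling π μ ν.1) : ∃ κ : X → Pp p d, Measurable κ ∧
      (∀ᵐ x ∂μ, disint π x = (κ x).1) ∧ ∀ f : Rd d → ℝ, GrowthP p f →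
        Integrable (fun x => ∫ y, f y ∂(κ x).1) μ ∧
          ∫ x, ∫ y, f y ∂(κ x).1 ∂μ = ∫ y, f y ∂ν.1 := by
  classical
  obtain ⟨hprob, hfst, hsnd⟩ := hπ
  have hd : disint π = π.condKernel := by
    unfold disint
    rw [dif_pos (inferInstance : IsFiniteMeasure π)]
  rw [hd]
  have hi : ∀ f : Rd d → ℝ, GrowthP p f → Integrable (fun q : X × Rd d => f q.2) π := fun f hf => by
    have h := GrowthP.integrable' hf hp ν
    rw [← hsnd] at h
    exact h.comp_measurable measurable_snd
  have hmeas : Measurable fun y : Rd d => ENNReal.ofReal (‖y‖ ^ p) := by fun_prop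
  let S : Set X := {x | ∫⁻ y, ENNReal.ofReal (‖y‖ ^ p) ∂(π.condKernel x) ≠ ⊤}
  have hS : MeasurableSet S := (hmeas.lintegral_kernel (measurableSet_singleton ⊤)).compl
  have hSae : ∀ᵐ x ∂μ, x ∈ S := by
    have h := (hi _ (growthP_wt hp)).condKernel_ae
    rw [show π.fst = μ from hfst] at h
    filter_upwards [h] with x hx
    refine ne_top_of_le_ne_top hx.lintegral_lt_top.ne (lintegral_mono fun y => ?_)
    exact ENNReal.ofReal_le_ofReal (by unfold wt; linarith)
  let κ : X → Pp p d := fun x => if h : x ∈ S then ⟨π.condKernel x, inferInstance, h⟩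
    else diracPp p 0
  have hκ : ∀ x ∈ S, (κ x).1 = π.condKernel x := fun x hx => by simp only [κ, dif_pos hx]
  have hκae : ∀ᵐ x ∂μ, π.condKernel x = (κ x).1 := hSae.mono fun x hx => (hκ x hx).symm
  refine ⟨κ, measurable_of_coord hp fun k => ?_, hκae, fun f hf => ?_⟩
  · have h1 : (fun x => coord k (κ x)) = fun x =>
        if x ∈ S then ∫ y, (testFn d k y : ℝ) ∂(π.condKernel x)
          else coord k (diracPp p (0 : Rd d)) := by
      funext x
      split_ifs with hx
      · rw [coord, hκ x hx]
      · simp only [κ, dif_neg hx]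
    rw [h1]
    refine Measurable.ite hS ?_ measurable_const
    have h2 : StronglyMeasurable fun y : Rd d => (testFn d k y : ℝ) :=
      (NNReal.continuous_coe.comp (continuous_testFn k)).stronglyMeasurable
    exact (h2.integral_kernel (κ := π.condKernel)).measurable
  · have h1 : (fun x => ∫ y, f y ∂(π.condKernel x)) =ᵐ[μ] fun x => ∫ y, f y ∂(κ x).1 :=
      hκae.mono fun x hx => by simp only [hx]
    have h2 := (hi f hf).integral_condKernel
    have h3 := Measure.integral_condKernel (hi f hf)
    rw [show π.fst = μ from hfst] at h2 h3
    refine ⟨h2.congr h1, ?_⟩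
    rw [← integral_congr_ae h1, h3, ← hsnd]
    exact (integral_map measurable_snd.aemeasurable hf.1.aestronglyMeasurable).symm

variable [TopologicalSpace X] [OpensMeasurableSpace X]

/-- Weak duality. -/
lemma dualVal_le_primal (hp : 1 ≤ p) {μ : Measure X} [IsProbabilityMeasure μ] (ν : Pp p d)
    {C : X → Measure (Rd d) → ℝ≥0∞}
    (hlsc : LowerSemicontinuous fun q : X × Pp p d => C q.1 q.2.1) (hψ : Cbp p ψ) :
    dualVal p μ ν.1 C ψ ≤ ((primal μ ν.1 C : ℝ≥0∞) : EReal) := by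
  have hg := growthP_of_cbp hp hψ
  obtain ⟨c, hc⟩ := hψ.2.1
  have hN : ∫⁻ x, erealToENN (-conj p C ψ x) ∂μ ≠ ⊤ := by
    refine ne_top_of_le_ne_top (b := ENNReal.ofReal (-c)) ENNReal.ofReal_ne_top ?_
    refine (lintegral_mono (g := fun _ => ENNReal.ofReal (-c)) fun x => ?_).trans_eq (by simp)
    have h1 : (c : EReal) ≤ conj p C ψ x := le_iInf fun ρ => by
      have h2 : c ≤ ∫ y, ψ y ∂ρ.1 := by
        simpa using integral_mono (integrable_const c) (GrowthP.integrable' hg hp ρ) hc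
      exact (EReal.coe_le_coe_iff.2 h2).trans
        (le_add_of_nonneg_right (EReal.coe_ennreal_nonneg _))
    have h3 : -conj p C ψ x ≤ ((-c : ℝ) : EReal) := by
      rw [EReal.coe_neg]
      exact EReal.neg_le_neg_iff.2 h1
    rw [erealToENN, if_neg (h3.trans_lt (EReal.coe_lt_top _)).ne]
    by_cases hbot : -conj p C ψ x = ⊥
    · simp [hbot]
    · exact ENNReal.ofReal_le_ofReal (EReal.toReal_le_toReal h3 hbot (EReal.coe_ne_top _))
  refine ((le_max_right _ _).trans_eq EReal.coe_toENNReal_eq_max.symm).trans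
    (EReal.coe_ennreal_le_coe_ennreal_iff.2 (le_iInf fun ⟨π, hπ⟩ => ?_))
  rw [← EReal.toENNReal_coe (x := ∫⁻ x, C x (disint π x) ∂μ)]
  refine EReal.toENNReal_le_toENNReal ?_
  obtain ⟨κ, hκ, hκae, hint⟩ := exists_disint_eq hp ν hπ
  obtain ⟨ha, haν⟩ := hint ψ hg
  set a : X → ℝ := fun x => ∫ y, ψ y ∂(κ x).1
  have hCκ : Measurable fun x => C x (κ x).1 := measurable_comp_graph hp hlsc hκ
  have ham : Measurable a := measurable_integral_comp hκ hg
  rw [lintegral_congr_ae (g := fun x => C x (κ x).1) (hκae.mono fun x hx => by simp only [hx])]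
  have ham' : Measurable fun x => ENNReal.ofReal (-a x) := ham.neg.ennreal_ofReal
  have hsum : Measurable fun x => ENNReal.ofReal (a x) + C x (κ x).1 := ham.ennreal_ofReal.add hCκ
  have hle : ∫⁻ x, erealToENN (conj p C ψ x) ∂μ + ∫⁻ x, ENNReal.ofReal (-a x) ∂μ ≤
      ∫⁻ x, erealToENN (-conj p C ψ x) ∂μ +
        (∫⁻ x, ENNReal.ofReal (a x) ∂μ + ∫⁻ x, C x (κ x).1 ∂μ) := by
    rw [← lintegral_add_left ham.ennreal_ofReal, ← lintegral_add_right _ ham',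
      ← lintegral_add_right _ hsum]
    exact lintegral_mono fun x => erealToENN_add_le (conj_le C ψ x (κ x))
  rw [dualVal, eInt, ← haν, integral_eq_lintegral_pos_part_sub_lintegral_neg_part ha]
  generalize (∫⁻ x, erealToENN (conj p C ψ x) ∂μ) = P at *
  generalize (∫⁻ x, erealToENN (-conj p C ψ x) ∂μ) = N at *
  generalize (∫⁻ x, C x (κ x).1 ∂μ) = B at *
  have hA : ∫⁻ x, ENNReal.ofReal (a x) ∂μ ≠ ⊤ := ha.lintegral_lt_top.ne
  have hA' : ∫⁻ x, ENNReal.ofReal (-a x) ∂μ ≠ ⊤ := ha.neg.lintegral_lt_top.ne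
  generalize (∫⁻ x, ENNReal.ofReal (a x) ∂μ) = A at *
  generalize (∫⁻ x, ENNReal.ofReal (-a x) ∂μ) = A' at *
  rcases eq_or_ne B ⊤ with rfl | hB
  · simp
  have hP : P ≠ ⊤ := ne_top_of_le_ne_top (ENNReal.add_ne_top.2 ⟨hN, ENNReal.add_ne_top.2 ⟨hA, hB⟩⟩)
    (le_self_add.trans hle)
  lift P to NNReal using hP
  lift N to NNReal using hN
  lift A to NNReal using hA
  lift A' to NNReal using hA'
  lift B to NNReal using hB
  have h1 : (P : ℝ) + A' ≤ N + (A + B) := by exact_mod_cast hle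
  change (((P : ℝ) : EReal) - ((N : ℝ) : EReal)) - (((A : ℝ) - (A' : ℝ) : ℝ) : EReal) ≤
    ((B : ℝ) : EReal)
  rw [← EReal.coe_sub, ← EReal.coe_sub, EReal.coe_le_coe_iff]
  linarith

end WeakTransport
/-- **Restriction of the dual problem to increasing convex potentials** (Theorem 5, forward
direction). If the cost `C` is lsc, convex in its second argument and decreasing for the
increasing convex order in its second argument, then weak-transport duality holds with
coordinatewise increasing convex potentials in `C_{b,p}`. -/
theorem weak_transport_duality_increasing_convex_potentials
    {X : Type*} [TopologicalSpace X] [PolishSpace X] [MeasurableSpace X] [BorelSpace X]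
    {d : ℕ} {p : ℝ} (hp : 1 ≤ p)
    (μ : Measure X) (hμ : IsProbabilityMeasure μ)
    (ν : Measure (Rd d)) (hν : IsProbabilityMeasure ν) (hνp : HasMomentP p ν)
    (C : X → Measure (Rd d) → ℝ≥0∞)
    (hlsc : LowerSemicontinuous fun q : X × Pp p d => C q.1 q.2.1)
    (hconv : ∀ x : X, ∀ ρ₁ ρ₂ : Pp p d, ∀ t : ℝ≥0∞, t ≤ 1 →
      C x (t • ρ₁.1 + (1 - t) • ρ₂.1) ≤ t * C x ρ₁.1 + (1 - t) * C x ρ₂.1)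
    (hmono : ∀ x : X, ∀ ρ₁ ρ₂ : Pp p d, IcxOrder ρ₁.1 ρ₂.1 → C x ρ₂.1 ≤ C x ρ₁.1) :
    ((primal μ ν C : ℝ≥0∞) : EReal)
      = ⨆ ψ : {ψ : Rd d → ℝ // Cbp p ψ ∧ ConvexOn ℝ Set.univ ψ ∧ CoordMono ψ},
          dualVal p μ ν C ψ.1 := by
  set V := ⨆ ψ : {ψ : Rd d → ℝ // Cbp p ψ ∧ ConvexOn ℝ Set.univ ψ ∧ CoordMono ψ},
    dualVal p μ ν C ψ.1
  let ν' : Pp p d := ⟨ν, hν, hνp⟩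
  refine le_antisymm ?_ (iSup_le fun ψ => WeakTransport.dualVal_le_primal hp ν' hlsc ψ.2.1)
  have hV0 : 0 ≤ V := by
    have hc : GrowthP p fun _ : Rd d => (0 : ℝ) := WeakTransport.growthP_const 0
    refine le_iSup_of_le ⟨fun _ => 0, WeakTransport.cbp_of_growthP hc fun _ => le_rfl,
      convexOn_const 0 convex_univ, fun _ _ _ => le_rfl⟩ ?_
    have h := WeakTransport.le_dualVal (p := p) (φ := fun _ : Rd d => (0 : ℝ)) (fun _ => le_rfl)
      (μ := μ) ν (C := C) (g := fun _ => 0) fun _ _ => zero_le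
    simpa using h
  have hV : ∀ s : ℝ, 0 ≤ s → ENNReal.ofReal s < primal μ ν C → ∀ η : ℝ, 0 < η →
      ((s - η : ℝ) : EReal) ≤ V := by
    intro s hs hlt η hη
    obtain ⟨ψ, hψ, hψ0, g, hg, hsg⟩ :=
      WeakTransport.exists_potential_of_lt_primal hp ν' hlsc hconv hs hlt hη
    have hφ := WeakTransport.growthP_envelope hp hψ hψ0
    have hφ0 : ∀ y, 0 ≤ WeakTransport.envelope p ψ y := WeakTransport.envelope_nonneg hψ0
    refine le_iSup_of_le ⟨WeakTransport.envelope p ψ, WeakTransport.cbp_of_growthP hφ hφ0,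
      WeakTransport.convexOn_envelope hp hψ hψ0, WeakTransport.coordMono_envelope hψ0⟩ ?_
    refine le_trans ?_ (WeakTransport.le_dualVal hφ0 ν
      (WeakTransport.le_integral_envelope_add hp hψ hψ0 hmono hg))
    have hle : ∫ y, WeakTransport.envelope p ψ y ∂ν ≤ ∫ y, ψ y ∂ν :=
      integral_mono (WeakTransport.GrowthP.integrable' hφ hp ν') (WeakTransport.GrowthP.integrable' hψ hp ν')
        (WeakTransport.envelope_le_self hψ0)
    generalize (∫⁻ x, g x ∂μ) = G at *
    rcases eq_or_ne G ⊤ with rfl | hG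
    · simp
    lift G to NNReal using hG
    have h1 : s + ∫ y, ψ y ∂ν ≤ G + η := by
      rw [← ENNReal.ofReal_coe_nnreal, ← ENNReal.ofReal_add G.coe_nonneg hη.le,
        ENNReal.ofReal_le_ofReal_iff (by positivity)] at hsg
      exact hsg
    change _ ≤ ((G : ℝ) : EReal) - _
    rw [← EReal.coe_sub, EReal.coe_le_coe_iff]
    linarith
  by_contra! hlt
  have htop : V ≠ ⊤ := ne_top_of_lt hlt
  lift V to ℝ using ⟨htop, (EReal.bot_lt_zero.trans_le hV0).ne'⟩ with r
  have hr : 0 ≤ r := by exact_mod_cast hV0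
  have hr' : ENNReal.ofReal r < primal μ ν C := by
    rw [← EReal.coe_ennreal_lt_coe_ennreal_iff, EReal.coe_ennreal_ofReal, max_eq_left hr]
    exact hlt
  obtain ⟨s, hrs, hs⟩ := ENNReal.lt_iff_exists_nnreal_btwn.1 hr'
  have hrs' : r < s := by
    rw [← ENNReal.ofReal_coe_nnreal] at hrs
    exact (ENNReal.ofReal_lt_ofReal_iff_of_nonneg hr).1 hrs
  have h := hV s s.coe_nonneg (by rwa [ENNReal.ofReal_coe_nnreal]) ((s - r) / 2) (by linarith)
  rw [EReal.coe_le_coe_iff] at h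
  linarith
end

section
/- Let X be a Polish space, p ≥ 1, and let C : X × P_p(ℝ^d) → [0,∞] be lower semicontinuous and convex in its second argument. If for all μ ∈ P(X) and all ν ∈ P_p(ℝ^d) the duality inf_{π ∈ Π(μ,ν)} ∫_X C(x, π_x) dμ(x) = sup { ∫_X ψ^C dμ − ∫_{ℝ^d} ψ dν : ψ ∈ C_{b,p}(ℝ^d), ψ convex and coordinatewise increasing } holds, then C is decreasing in the increasing convex order in its second argument, i.e. ρ₁ ≼_icx ρ₂ implies C(x,ρ₁) ≥ C(x,ρ₂) for all x ∈ X. -/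
open MeasureTheory Set Filter Topology
open scoped ENNReal

theorem HasMomentP.integrable_norm_rpow {p : ℝ} {d : ℕ} {ρ : Measure (Rd d)}
    (h : HasMomentP p ρ) (hp : 0 ≤ p) : Integrable (fun y => ‖y‖ ^ p) ρ := by
  have hc : Continuous fun y : Rd d => ‖y‖ ^ p :=
    continuous_norm.rpow_const fun _ => Or.inr hp
  exact (lintegral_ofReal_ne_top_iff_integrable hc.aestronglyMeasurable
    (ae_of_all _ fun y => by positivity)).1 h

theorem Cbp.integrable {p : ℝ} (hp : 1 ≤ p) {d : ℕ} {ψ : Rd d → ℝ} (hψ : Cbp p ψ)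
    {ρ : Measure (Rd d)} [IsFiniteMeasure ρ] (hρ : HasMomentP p ρ) : Integrable ψ ρ := by
  obtain ⟨hcont, ⟨c, hc⟩, K, hK, y₀, hle⟩ := hψ
  have hg : Integrable (fun y : Rd d => |c| + K * (1 + 2 ^ (p - 1) * (‖y‖ ^ p + ‖y₀‖ ^ p))) ρ :=
    (integrable_const _).add (((integrable_const _).add
      (((hρ.integrable_norm_rpow (by linarith)).add (integrable_const _)).const_mul _)).const_mul _)
  refine hg.mono' hcont.aestronglyMeasurable (ae_of_all _ fun y => ?_)
  have h1 : ‖y - y₀‖ ^ p ≤ 2 ^ (p - 1) * (‖y‖ ^ p + ‖y₀‖ ^ p) :=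
    (Real.rpow_le_rpow (norm_nonneg _) (norm_sub_le _ _) (by linarith)).trans
      (by exact_mod_cast NNReal.rpow_add_le_mul_rpow_add_rpow ‖y‖₊ ‖y₀‖₊ hp)
  have h2 : ψ y ≤ K * (1 + 2 ^ (p - 1) * (‖y‖ ^ p + ‖y₀‖ ^ p)) :=
    (hle y).trans (mul_le_mul_of_nonneg_left (by linarith) hK.le)
  have h3 : 0 ≤ K * (1 + 2 ^ (p - 1) * (‖y‖ ^ p + ‖y₀‖ ^ p)) := by positivity
  rw [Real.norm_eq_abs, abs_le]
  exact ⟨by linarith [hc y, neg_abs_le c], by linarith [abs_nonneg c]⟩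

theorem eInt_coe_of_integrable {α : Type*} [MeasurableSpace α] {μ : Measure α} {f : α → ℝ}
    (hf : Integrable f μ) : eInt μ (fun y => (f y : EReal)) = ((∫ y, f y ∂μ : ℝ) : EReal) := by
  have hpos (r : ℝ) : erealToENN (r : EReal) = ENNReal.ofReal r := by simp [erealToENN]
  have hneg (r : ℝ) : erealToENN (-(r : EReal)) = ENNReal.ofReal (-r) := by
    rw [← EReal.coe_neg, hpos]
  have coe_toReal {a : ℝ≥0∞} (ha : a ≠ ⊤) : (a : EReal) = (a.toReal : EReal) := by
    conv_lhs => rw [← ENNReal.ofReal_toReal ha]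
    rw [EReal.coe_ennreal_ofReal, max_eq_left ENNReal.toReal_nonneg]
  simp only [eInt, hpos, hneg]
  rw [integral_eq_lintegral_pos_part_sub_lintegral_neg_part hf, EReal.coe_sub,
    coe_toReal hf.lintegral_lt_top.ne, coe_toReal (show ∫⁻ y, ENNReal.ofReal (-f y) ∂μ ≠ ⊤ from hf.neg.lintegral_lt_top.ne)]

theorem IsCoupling.apply_singleton_prod_of_dirac {X Y : Type*} [MeasurableSpace X]
    [MeasurableSingletonClass X] [MeasurableSpace Y] {π : Measure (X × Y)} {x : X} {ν : Measure Y}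
    (h : IsCoupling π (Measure.dirac x) ν) {s : Set Y} (hs : MeasurableSet s) :
    π ({x} ×ˢ s) = ν s := by
  obtain ⟨-, h1, h2⟩ := h
  have h0 : π (Prod.fst ⁻¹' {x}ᶜ) = 0 := by
    rw [← Measure.map_apply measurable_fst (measurableSet_singleton x).compl, h1]
    simp
  rw [← h2, Measure.map_apply measurable_snd hs, Set.prod_eq, Set.inter_comm]
  exact measure_inter_conull h0

theorem IsCoupling.disint_of_dirac {X Y : Type*} [MeasurableSpace X]
    [MeasurableSingletonClass X] [MeasurableSpace Y] [StandardBorelSpace Y] [Nonempty Y]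
    {π : Measure (X × Y)} {x : X} {ν : Measure Y}
    (h : IsCoupling π (Measure.dirac x) ν) : disint π x = ν := by
  have := h.1
  have hfst : π.fst {x} = 1 := by rw [Measure.fst, h.2.1]; simp
  ext s hs
  rw [disint, dif_pos (inferInstanceAs (IsFiniteMeasure π)),
    Measure.condKernel_apply_of_ne_zero (by rw [hfst]; exact one_ne_zero), hfst,
    h.apply_singleton_prod_of_dirac hs]
  simp

theorem primal_dirac {X : Type*} [MeasurableSpace X] [MeasurableSingletonClass X] {d : ℕ}
    (x : X) (ν : Measure (Rd d)) [IsProbabilityMeasure ν] (C : X → Measure (Rd d) → ℝ≥0∞) :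
    primal (Measure.dirac x) ν C = C x ν := by
  have : Nonempty {π : Measure (X × Rd d) // IsCoupling π (Measure.dirac x) ν} :=
    ⟨⟨(Measure.dirac x).prod ν, inferInstance, by simp, by simp⟩⟩
  simp only [primal, lintegral_dirac]
  exact (iInf_congr fun π => by rw [π.2.disint_of_dirac]).trans iInf_const

/-- **Theorem 5, converse direction.** If weak-transport duality with increasing convex
potentials holds for all marginals `μ ∈ P(X)`, `ν ∈ P_p(ℝ^d)`, then the cost `C` is
decreasing for the increasing convex order in its second argument. -/
theorem icxOrder_decreasing_of_duality
    {X : Type*} [TopologicalSpace X] [PolishSpace X] [MeasurableSpace X] [BorelSpace X]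
    {d : ℕ} {p : ℝ} (hp : 1 ≤ p)
    (C : X → Measure (Rd d) → ℝ≥0∞)
    (hlsc : LowerSemicontinuous fun q : X × Pp p d => C q.1 q.2.1)
    (hconv : ∀ x : X, ∀ ρ₁ ρ₂ : Pp p d, ∀ t : ℝ≥0∞, t ≤ 1 →
      C x (t • ρ₁.1 + (1 - t) • ρ₂.1) ≤ t * C x ρ₁.1 + (1 - t) * C x ρ₂.1)
    (hdual : ∀ μ : Measure X, IsProbabilityMeasure μ →
      ∀ ν : Measure (Rd d), IsProbabilityMeasure ν → HasMomentP p ν →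
      ((primal μ ν C : ℝ≥0∞) : EReal)
        = ⨆ ψ : {ψ : Rd d → ℝ // Cbp p ψ ∧ ConvexOn ℝ Set.univ ψ ∧ CoordMono ψ},
            dualVal p μ ν C ψ.1) :
    ∀ x : X, ∀ ρ₁ ρ₂ : Pp p d, IcxOrder ρ₁.1 ρ₂.1 → C x ρ₂.1 ≤ C x ρ₁.1 := by
  intro x ρ₁ ρ₂ h
  have := ρ₁.2.1
  have := ρ₂.2.1
  have key (ρ : Pp p d) : ((C x ρ.1 : ℝ≥0∞) : EReal)
      = ⨆ ψ : {ψ : Rd d → ℝ // Cbp p ψ ∧ ConvexOn ℝ Set.univ ψ ∧ CoordMono ψ},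
          dualVal p (Measure.dirac x) ρ.1 C ψ.1 := by
    have := ρ.2.1
    rw [← hdual _ inferInstance ρ.1 ρ.2.1 ρ.2.2, primal_dirac]
  rw [← EReal.coe_ennreal_le_coe_ennreal_iff, key, key]
  refine iSup_mono fun ψ => EReal.sub_le_sub le_rfl ?_
  have hψ := h ψ.1 ψ.2.2.1 ψ.2.2.2
  rwa [eInt_coe_of_integrable (ψ.2.1.integrable hp ρ₁.2.2),
    eInt_coe_of_integrable (ψ.2.1.integrable hp ρ₂.2.2)] at hψ
end
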